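/- arXiv:1907.08729 — 8 statements merged into one kernel-verified Lean document; each statement's English description precedes it below -/
import Mathlib

section
/- Let n be a positive integer and let {a_{i,j}}_{1≤i,j≤n} be real numbers with a_{i,j} ∈ [0,1]. Let σ be a uniformly random permutation of [n] = {1,…,n} and set T3 = Σ_{i=1}^n a_{i,σ(i)}. Then for every t > 0, P(|T3 − E[T3]| ≥ t) ≤ 2·exp(−t² / (4·E[T3] + 2t)). -/
open scoped Classical

namespace HoeffdingStatistic

lemma exp_sub_one_le {d : ℝ} (hd : 0 ≤ d) :
    Real.exp d - 1 ≤ d / 2 * (Real.exp d + 1) := by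
  have hderiv : ∀ u : ℝ, HasDerivAt (fun u => u / 2 * (Real.exp u + 1) - Real.exp u)
      (1 / 2 * (Real.exp u + 1) + u / 2 * Real.exp u - Real.exp u) u := fun u =>
    (((hasDerivAt_id u).div_const 2).mul ((Real.hasDerivAt_exp u).add_const 1)).sub
      (Real.hasDerivAt_exp u)
  have hmono : Monotone (fun u : ℝ => u / 2 * (Real.exp u + 1) - Real.exp u) := by
    refine monotone_of_deriv_nonneg (fun u => (hderiv u).differentiableAt) fun u => ?_
    rw [(hderiv u).deriv]
    have h := mul_le_mul_of_nonneg_right (Real.add_one_le_exp (-u)) (Real.exp_pos u).le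
    rw [← Real.exp_add, neg_add_cancel, Real.exp_zero] at h
    linarith
  have h := hmono hd
  simp only [Real.exp_zero] at h
  linarith

lemma sub_mul_exp_sub_exp_le (x y : ℝ) :
    (x - y) * (Real.exp x - Real.exp y) ≤ (x - y) ^ 2 / 2 * (Real.exp x + Real.exp y) := by
  wlog h : y ≤ x generalizing x y
  · linarith [this y x (le_of_not_ge h)]
  have hxy : Real.exp x = Real.exp y * Real.exp (x - y) := by
    rw [← Real.exp_add]
    ring_nf
  have hd : 0 ≤ x - y := sub_nonneg.2 h
  have key := mul_le_mul_of_nonneg_left (exp_sub_one_le hd)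
    (mul_nonneg hd (Real.exp_pos y).le)
  rw [hxy]
  linarith

/-- An exponential bound from the differential inequality `g' ≤ K u g`. -/
lemma le_mul_exp_of_deriv_le {g g' : ℝ → ℝ} {K θ : ℝ} (hθ : 0 ≤ θ)
    (hg : ∀ u, HasDerivAt g (g' u) u)
    (hle : ∀ u, 0 < u → u < θ → g' u ≤ K * u * g u) :
    g θ ≤ g 0 * Real.exp (K * θ ^ 2 / 2) := by
  have hderiv : ∀ u, HasDerivAt (fun u => g u * Real.exp (-(K * u ^ 2 / 2)))
      ((g' u - K * u * g u) * Real.exp (-(K * u ^ 2 / 2))) u := by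
    intro u
    have hpow : HasDerivAt (fun u : ℝ => -(K * u ^ 2 / 2)) (-(K * u)) u := by
      refine (((hasDerivAt_pow 2 u).const_mul K).div_const 2).neg.congr_deriv ?_
      norm_num
      ring
    refine ((hg u).mul hpow.exp).congr_deriv ?_
    ring
  have hanti : AntitoneOn (fun u => g u * Real.exp (-(K * u ^ 2 / 2))) (Set.Icc 0 θ) := by
    refine antitoneOn_of_deriv_nonpos (convex_Icc 0 θ)
      (fun u _ => (hderiv u).continuousAt.continuousWithinAt)
      (fun u _ => (hderiv u).differentiableAt.differentiableWithinAt) fun u hu => ?_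
    rw [interior_Icc] at hu
    rw [(hderiv u).deriv]
    exact mul_nonpos_of_nonpos_of_nonneg (sub_nonpos.2 (hle u hu.1 hu.2)) (Real.exp_pos _).le
  have h := hanti (Set.left_mem_Icc.2 hθ) (Set.right_mem_Icc.2 hθ) hθ
  simp only [Real.exp_neg, ← div_eq_mul_inv] at h
  rw [div_le_iff₀ (Real.exp_pos _)] at h
  simpa using h

variable {n : ℕ} (a : Fin n → Fin n → ℝ)

lemma sum_sub_sum_mul_swap (σ : Equiv.Perm (Fin n)) (i j : Fin n) :
    (∑ k, a k (σ k)) - ∑ k, a k ((σ * Equiv.swap i j) k) =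
      a i (σ i) + a j (σ j) - a i (σ j) - a j (σ i) := by
  rcases eq_or_ne i j with rfl | hij
  · simp
  · rw [← Finset.sum_sub_distrib, Fintype.sum_eq_add i j hij]
    · simp only [Equiv.Perm.mul_apply, Equiv.swap_apply_left, Equiv.swap_apply_right]
      ring
    · rintro k ⟨hki, hkj⟩
      simp [Equiv.swap_apply_of_ne_of_ne hki hkj]

lemma sum_sum_diag_add (σ : Equiv.Perm (Fin n)) :
    ∑ i, ∑ j, (a i (σ i) + a j (σ j)) = 2 * n * ∑ i, a i (σ i) := by
  simp only [Finset.sum_add_distrib, Finset.sum_const, Finset.card_univ, Fintype.card_fin,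
    nsmul_eq_mul, ← Finset.mul_sum]
  ring

lemma sum_sum_cross_add (σ : Equiv.Perm (Fin n)) :
    ∑ i, ∑ j, (a i (σ j) + a j (σ i)) = 2 * ∑ i, ∑ j, a i j := by
  have h1 : ∀ i, ∑ j, a i (σ j) = ∑ j, a i j := fun i => Equiv.sum_comp σ (a i)
  have h2 : ∑ i, ∑ j, a j (σ i) = ∑ i, ∑ j, a i (σ j) := Finset.sum_comm
  simp only [Finset.sum_add_distrib, h2, h1]
  ring

/-- The deviation of `∑ i, a i (σ i)` from its mean over uniform `σ`. -/
noncomputable def deviation (σ : Equiv.Perm (Fin n)) : ℝ :=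
  (∑ i, a i (σ i)) - (∑ i, ∑ j, a i j) / n

lemma deviation_sub_mul_swap (σ : Equiv.Perm (Fin n)) (i j : Fin n) :
    deviation a σ - deviation a (σ * Equiv.swap i j) =
      a i (σ i) + a j (σ j) - a i (σ j) - a j (σ i) := by
  rw [← sum_sub_sum_mul_swap, deviation, deviation]
  ring

lemma sum_sum_deviation_sub (hn : 0 < n) (σ : Equiv.Perm (Fin n)) :
    ∑ i, ∑ j, (deviation a σ - deviation a (σ * Equiv.swap i j)) =
      2 * n * deviation a σ := by
  have hn' : (n : ℝ) ≠ 0 := by positivity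
  calc _ = ∑ i, ∑ j, (a i (σ i) + a j (σ j)) - ∑ i, ∑ j, (a i (σ j) + a j (σ i)) := by
        simp only [deviation_sub_mul_swap, ← Finset.sum_sub_distrib, sub_sub]
    _ = _ := by
        rw [sum_sum_diag_add, sum_sum_cross_add, deviation]
        field_simp

lemma sum_sum_deviation_sub_sq_le (hn : 0 < n) (ha : ∀ i j, a i j ∈ Set.Icc (0 : ℝ) 1)
    (σ : Equiv.Perm (Fin n)) :
    ∑ i, ∑ j, (deviation a σ - deviation a (σ * Equiv.swap i j)) ^ 2 ≤
      4 * n * (deviation a σ + 2 * ((∑ i, ∑ j, a i j) / n)) := by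
  have hn' : (n : ℝ) ≠ 0 := by positivity
  calc ∑ i, ∑ j, (deviation a σ - deviation a (σ * Equiv.swap i j)) ^ 2
      ≤ ∑ i, ∑ j, 2 * ((a i (σ i) + a j (σ j)) + (a i (σ j) + a j (σ i))) := by
        refine Finset.sum_le_sum fun i _ => Finset.sum_le_sum fun j _ => ?_
        rw [deviation_sub_mul_swap]
        obtain ⟨h1, h2⟩ := ha i (σ i)
        obtain ⟨h3, h4⟩ := ha j (σ j)
        obtain ⟨h5, h6⟩ := ha i (σ j)
        obtain ⟨h7, h8⟩ := ha j (σ i)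
        generalize hx : a i (σ i) + a j (σ j) = x
        generalize hy : a i (σ j) + a j (σ i) = y
        have hx0 : 0 ≤ x := by linarith
        have hx2 : x ≤ 2 := by linarith
        have hy0 : 0 ≤ y := by linarith
        have hy2 : y ≤ 2 := by linarith
        rw [sub_sub, hy]
        nlinarith [mul_nonneg hx0 hy0, mul_nonneg hx0 (sub_nonneg.2 hx2),
          mul_nonneg hy0 (sub_nonneg.2 hy2)]
    _ = 2 * (2 * n * ∑ i, a i (σ i) + 2 * ∑ i, ∑ j, a i j) := by
        rw [← sum_sum_diag_add, ← sum_sum_cross_add a σ]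
        simp only [← Finset.mul_sum, ← Finset.sum_add_distrib]
    _ = 4 * n * (deviation a σ + 2 * ((∑ i, ∑ j, a i j) / n)) := by
        rw [deviation]
        field_simp
        ring

lemma sum_perm_mul_swap (F : Equiv.Perm (Fin n) → Equiv.Perm (Fin n) → ℝ) (i j : Fin n) :
    ∑ σ, F (σ * Equiv.swap i j) σ = ∑ σ, F σ (σ * Equiv.swap i j) := by
  rw [← Equiv.sum_comp (Equiv.mulRight (Equiv.swap i j))]
  simp [mul_assoc]

/-- Chatterjee's exchangeable pairs bound for the derivative of the moment generating function
of `s * deviation a`, where `s` is a sign. -/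
lemma sum_mul_exp_le (hn : 0 < n) (ha : ∀ i j, a i j ∈ Set.Icc (0 : ℝ) 1) {s u : ℝ}
    (hs : s ^ 2 = 1) (hu : 0 ≤ u) :
    ∑ σ, s * deviation a σ * Real.exp (u * (s * deviation a σ)) ≤
      u * ∑ σ, (deviation a σ + 2 * ((∑ i, ∑ j, a i j) / n)) *
        Real.exp (u * (s * deviation a σ)) := by
  have hn' : (0 : ℝ) < n := by exact_mod_cast hn
  set f : Equiv.Perm (Fin n) → ℝ := deviation a with hf
  set e : Equiv.Perm (Fin n) → ℝ := fun σ => Real.exp (u * (s * f σ)) with he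
  have hpair : ∀ i j : Fin n,
      ∑ σ, s * (f σ - f (σ * Equiv.swap i j)) * e σ ≤
        u / 2 * ∑ σ, (f σ - f (σ * Equiv.swap i j)) ^ 2 * e σ := by
    intro i j
    have h1 := sum_perm_mul_swap (fun σ τ => s * (f σ - f τ) * e σ) i j
    have h2 := sum_perm_mul_swap (fun σ τ => (f σ - f τ) ^ 2 * e σ) i j
    have h3 : ∑ σ, (s * (f σ - f (σ * Equiv.swap i j)) * e σ +
          s * (f (σ * Equiv.swap i j) - f σ) * e (σ * Equiv.swap i j)) ≤
        ∑ σ, u / 2 * ((f σ - f (σ * Equiv.swap i j)) ^ 2 * e σ +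
          (f (σ * Equiv.swap i j) - f σ) ^ 2 * e (σ * Equiv.swap i j)) := by
      refine Finset.sum_le_sum fun σ _ => ?_
      rcases hu.eq_or_lt with rfl | hu
      · simp only [he, zero_mul, Real.exp_zero]
        linarith
      have h := sub_mul_exp_sub_exp_le (u * (s * f σ)) (u * (s * f (σ * Equiv.swap i j)))
      refine le_of_mul_le_mul_left ?_ hu
      calc _ = (u * (s * f σ) - u * (s * f (σ * Equiv.swap i j))) *
            (e σ - e (σ * Equiv.swap i j)) := by ring
        _ ≤ _ := h
        _ = s ^ 2 * (u ^ 2 * (f σ - f (σ * Equiv.swap i j)) ^ 2 / 2 *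
            (e σ + e (σ * Equiv.swap i j))) := by ring
        _ = _ := by rw [hs]; ring
    rw [Finset.sum_add_distrib, ← Finset.mul_sum, Finset.sum_add_distrib, h1, h2] at h3
    linarith
  have hsum := Finset.sum_le_sum fun i (_ : i ∈ Finset.univ) =>
    Finset.sum_le_sum fun j (_ : j ∈ Finset.univ) => hpair i j
  have hcomm : ∀ F : Equiv.Perm (Fin n) → Fin n → Fin n → ℝ,
      ∑ i, ∑ j, ∑ σ, F σ i j = ∑ σ, ∑ i, ∑ j, F σ i j := by
    intro F
    rw [Finset.sum_comm (s := (Finset.univ : Finset (Equiv.Perm (Fin n))))]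
    exact Finset.sum_congr rfl fun i _ => Finset.sum_comm
  simp only [← Finset.mul_sum] at hsum
  rw [hcomm, hcomm] at hsum
  have hleft : ∀ σ, ∑ i, ∑ j, s * (f σ - f (σ * Equiv.swap i j)) * e σ =
      2 * n * (s * f σ * e σ) := by
    intro σ
    simp only [← Finset.sum_mul, ← Finset.mul_sum]
    rw [hf, sum_sum_deviation_sub a hn σ]
    ring
  have hright : ∀ σ, ∑ i, ∑ j, (f σ - f (σ * Equiv.swap i j)) ^ 2 * e σ ≤
      4 * n * ((f σ + 2 * ((∑ i, ∑ j, a i j) / n)) * e σ) := by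
    intro σ
    simp only [← Finset.sum_mul]
    rw [← mul_assoc]
    exact mul_le_mul_of_nonneg_right (sum_sum_deviation_sub_sq_le a hn ha σ) (Real.exp_pos _).le
  have hfinal := hsum.trans (mul_le_mul_of_nonneg_left
    (Finset.sum_le_sum fun σ _ => hright σ) (by positivity))
  simp only [hleft, ← Finset.mul_sum] at hfinal
  refine le_of_mul_le_mul_left ?_ (by positivity : (0 : ℝ) < 2 * n)
  linarith

/-- One-sided tail bound for `s * deviation a`, where `s` is a sign. -/
lemma card_filter_le (hn : 0 < n) (ha : ∀ i j, a i j ∈ Set.Icc (0 : ℝ) 1) {s t : ℝ}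
    (hs : s = 1 ∨ s = -1) (hμ : 0 < (∑ i, ∑ j, a i j) / n) (ht : 0 < t) :
    ((Finset.univ.filter fun σ => t ≤ s * deviation a σ).card : ℝ) ≤
      Fintype.card (Equiv.Perm (Fin n)) *
        Real.exp (-t ^ 2 / (4 * ((∑ i, ∑ j, a i j) / n) + 2 * t)) := by
  set μ : ℝ := (∑ i, ∑ j, a i j) / n
  set θ : ℝ := t / (2 * μ + t)
  set K : ℝ := 2 * μ / (1 - θ)
  have hθ0 : 0 < θ := by positivity
  have hθ1 : 0 < 1 - θ := by
    rw [sub_pos, div_lt_one (by positivity)]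
    linarith
  let g : ℝ → ℝ := fun u => ∑ σ, Real.exp (u * (s * deviation a σ))
  let g' : ℝ → ℝ := fun u => ∑ σ, s * deviation a σ * Real.exp (u * (s * deviation a σ))
  have hg : ∀ u, HasDerivAt g (g' u) u := by
    intro u
    refine HasDerivAt.fun_sum fun σ _ => ?_
    refine ((hasDerivAt_id u).mul_const (s * deviation a σ)).exp.congr_deriv ?_
    simp only [id]
    ring
  have hgpos : ∀ u, 0 ≤ g u := fun u => Finset.sum_nonneg fun σ _ => (Real.exp_pos _).le
  have hle : ∀ u, 0 < u → u < θ → g' u ≤ K * u * g u := by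
    intro u hu huθ
    have hs2 : s ^ 2 = 1 := by rcases hs with rfl | rfl <;> norm_num
    have h := sum_mul_exp_le a hn ha hs2 hu.le
    have hsplit : ∑ σ, (deviation a σ + 2 * μ) * Real.exp (u * (s * deviation a σ)) =
        s * g' u + 2 * μ * g u := by
      simp only [g, g', Finset.mul_sum, ← Finset.sum_add_distrib]
      refine Finset.sum_congr rfl fun σ _ => ?_
      linear_combination (-(deviation a σ * Real.exp (u * (s * deviation a σ)))) * hs2
    rw [hsplit] at h
    change g' u ≤ _ at h
    have hRHS : 0 ≤ 2 * μ * u * g u := by have := hgpos u; positivity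
    have hdiff : g' u * (1 - θ) ≤ 2 * μ * u * g u := by
      rcases le_or_gt (g' u) 0 with hneg | hpos
      · exact (mul_nonpos_of_nonpos_of_nonneg hneg hθ1.le).trans hRHS
      · rcases hs with rfl | rfl <;> nlinarith
    rw [← le_div_iff₀ hθ1] at hdiff
    exact hdiff.trans_eq (by simp only [K]; ring)
  have hmgf := le_mul_exp_of_deriv_le hθ0.le hg hle
  have hg0 : g 0 = Fintype.card (Equiv.Perm (Fin n)) := by simp [g, Finset.card_univ]
  have hmarkov : ((Finset.univ.filter fun σ => t ≤ s * deviation a σ).card : ℝ) *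
      Real.exp (θ * t) ≤ g θ := by
    rw [← nsmul_eq_mul]
    refine (Finset.card_nsmul_le_sum _ (fun σ => Real.exp (θ * (s * deviation a σ))) _
      fun σ hσ => ?_).trans (Finset.sum_le_sum_of_subset_of_nonneg (Finset.filter_subset _ _)
        fun σ _ _ => (Real.exp_pos _).le)
    exact Real.exp_le_exp.2 (mul_le_mul_of_nonneg_left (Finset.mem_filter.1 hσ).2 hθ0.le)
  have hexponent : K * θ ^ 2 / 2 = θ * t + -t ^ 2 / (4 * μ + 2 * t) := by
    have hK : K = 2 * μ + t := by
      have h1 : 1 - θ = 2 * μ / (2 * μ + t) := by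
        simp only [θ]
        field_simp
        ring
      simp only [K]
      rw [h1]
      field_simp
    rw [hK, show 4 * μ + 2 * t = 2 * (2 * μ + t) by ring]
    simp only [θ]
    field_simp
    ring
  rw [hg0, hexponent, Real.exp_add] at hmgf
  refine le_of_mul_le_mul_right ?_ (Real.exp_pos (θ * t))
  linarith [hmarkov.trans hmgf]

end HoeffdingStatistic

open HoeffdingStatistic

/-- Bernstein-type concentration (Chatterjee) for `T₃ = ∑ i, a i (σ i)` with `σ`
uniform on permutations of `Fin n`, where `E[T₃] = (∑ i, ∑ j, a i j) / n`. -/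
theorem hoeffding_statistic_concentration
    (n : ℕ) (hn : 0 < n) (a : Fin n → Fin n → ℝ)
    (ha : ∀ i j, a i j ∈ Set.Icc (0 : ℝ) 1) (t : ℝ) (ht : 0 < t) :
    ((Finset.univ.filter fun σ : Equiv.Perm (Fin n) =>
        t ≤ |(∑ i, a i (σ i)) - (∑ i, ∑ j, a i j) / n|).card : ℝ) /
      (Fintype.card (Equiv.Perm (Fin n)) : ℝ) ≤
    2 * Real.exp (-t ^ 2 / (4 * ((∑ i, ∑ j, a i j) / n) + 2 * t)) := by
  have hsum_nonneg : 0 ≤ ∑ i, ∑ j, a i j :=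
    Finset.sum_nonneg fun i _ => Finset.sum_nonneg fun j _ => (ha i j).1
  have hn' : (0 : ℝ) < n := by exact_mod_cast hn
  rw [div_le_iff₀ (by exact_mod_cast Fintype.card_pos)]
  change ((Finset.univ.filter fun σ => t ≤ |deviation a σ|).card : ℝ) ≤ _
  rcases hsum_nonneg.eq_or_lt with h0 | hpos
  · have hzero : ∀ i j, a i j = 0 := by
      intro i j
      have hi := (Finset.sum_eq_zero_iff_of_nonneg fun i _ =>
        Finset.sum_nonneg fun j _ => (ha i j).1).1 h0.symm i (Finset.mem_univ i)
      exact (Finset.sum_eq_zero_iff_of_nonneg fun j _ => (ha i j).1).1 hi j (Finset.mem_univ j)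
    have hempty : (Finset.univ.filter fun σ => t ≤ |deviation a σ|) = ∅ := by
      simp [deviation, hzero, ht]
    rw [hempty]
    simp only [Finset.card_empty, Nat.cast_zero]
    positivity
  · have hμ : 0 < (∑ i, ∑ j, a i j) / n := div_pos hpos hn'
    have hupper := card_filter_le a hn ha (.inl rfl) hμ ht
    have hlower := card_filter_le a hn ha (.inr rfl) hμ ht
    have hunion : (Finset.univ.filter fun σ => t ≤ |deviation a σ|) ⊆
        (Finset.univ.filter fun σ => t ≤ 1 * deviation a σ) ∪
          Finset.univ.filter fun σ => t ≤ -1 * deviation a σ := by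
      intro σ hσ
      simpa [le_abs] using hσ
    have hcard : ((Finset.univ.filter fun σ => t ≤ |deviation a σ|).card : ℝ) ≤
        (Finset.univ.filter fun σ => t ≤ 1 * deviation a σ).card +
          (Finset.univ.filter fun σ => t ≤ -1 * deviation a σ).card := by
      exact_mod_cast (Finset.card_le_card hunion).trans (Finset.card_union_le _ _)
    linarith
end

section
/- Let σ be a uniformly random permutation of [n] and set T1 = Σ_{i=1}^n Σ_{j=1}^n a_{i,j,σ(i)}. Then for every t > 0, P(|T1 − μ1| ≥ t) ≤ 2·exp(−t² / (2n·(2μ1 + t))). -/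
open scoped Classical

theorem sinh_le_mul_cosh {u : ℝ} (hu : 0 ≤ u) : Real.sinh u ≤ u * Real.cosh u := by
  have hd : ∀ x : ℝ, HasDerivAt (fun x => x * Real.cosh x - Real.sinh x) (x * Real.sinh x) x := by
    intro x
    exact (((hasDerivAt_id' x).fun_mul (Real.hasDerivAt_cosh x)).fun_sub
      (Real.hasDerivAt_sinh x)).congr_deriv (by ring)
  have hmono : MonotoneOn (fun x => x * Real.cosh x - Real.sinh x) (Set.Ici 0) := by
    refine monotoneOn_of_deriv_nonneg (convex_Ici 0)
      (fun x _ => (hd x).continuousAt.continuousWithinAt)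
      (fun x _ => (hd x).differentiableAt.differentiableWithinAt) fun x hx => ?_
    rw [interior_Ici] at hx
    rw [(hd x).deriv]
    exact mul_nonneg hx.le (Real.sinh_nonneg_iff.2 hx.le)
  have h := hmono Set.self_mem_Ici hu hu
  simp only [Real.sinh_zero, zero_mul, sub_zero] at h
  linarith

/-- The trapezoidal rule overestimates the integral of the exponential. -/
theorem exp_sub_exp_le {x y : ℝ} (h : y ≤ x) :
    Real.exp x - Real.exp y ≤ (x - y) / 2 * (Real.exp x + Real.exp y) := by
  have hs := sinh_le_mul_cosh (u := (x - y) / 2) (by linarith)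
  rw [Real.sinh_eq, Real.cosh_eq] at hs
  have hx : Real.exp x = Real.exp ((x + y) / 2) * Real.exp ((x - y) / 2) := by
    rw [← Real.exp_add]; ring_nf
  have hy : Real.exp y = Real.exp ((x + y) / 2) * Real.exp (-((x - y) / 2)) := by
    rw [← Real.exp_add]; ring_nf
  rw [hx, hy]
  nlinarith [mul_le_mul_of_nonneg_left hs (Real.exp_pos ((x + y) / 2)).le]

theorem exp_sub_exp_mul_le {x y θ w : ℝ} (hθ : 0 ≤ θ) (h : x - y = θ * w) :
    (Real.exp x - Real.exp y) * w ≤ θ / 2 * w ^ 2 * (Real.exp x + Real.exp y) := by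
  rcases le_total 0 w with hw | hw
  · have := exp_sub_exp_le (x := x) (y := y) (by nlinarith [mul_nonneg hθ hw])
    rw [h] at this
    nlinarith [mul_le_mul_of_nonneg_right this hw]
  · have := exp_sub_exp_le (x := y) (y := x) (by nlinarith [mul_nonneg hθ (neg_nonneg.2 hw)])
    rw [show y - x = -(θ * w) by linarith] at this
    nlinarith [mul_le_mul_of_nonneg_right this (neg_nonneg.2 hw)]

section PermutationSum

variable {α : Type*} [Fintype α]

/-- The sum of the entries of `b` selected by the permutation `σ`. -/
def permSum (b : α → α → ℝ) (σ : Equiv.Perm α) : ℝ := ∑ i, b i (σ i)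

/-- The mean of `permSum b σ` for uniform `σ`. -/
noncomputable def permMean (b : α → α → ℝ) : ℝ := (∑ i, ∑ k, b i k) / Fintype.card α

theorem sum_sum_apply_perm (b : α → α → ℝ) (σ : Equiv.Perm α) :
    ∑ i, ∑ j, b i (σ j) = ∑ i, ∑ k, b i k :=
  Finset.sum_congr rfl fun i _ => Equiv.sum_comp σ (b i)

theorem card_mul_permMean [Nonempty α] (b : α → α → ℝ) :
    Fintype.card α * permMean b = ∑ i, ∑ k, b i k := by
  rw [permMean]
  field_simp

theorem permMean_nonneg {b : α → α → ℝ} (hb : ∀ i k, b i k ∈ Set.Icc (0 : ℝ) 1) :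
    0 ≤ permMean b :=
  div_nonneg (Finset.sum_nonneg fun i _ => Finset.sum_nonneg fun k _ => (hb i k).1)
    (Nat.cast_nonneg _)

variable [DecidableEq α]

theorem permSum_sub_permSum_mul_swap (b : α → α → ℝ) (σ : Equiv.Perm α) (i j : α) :
    permSum b σ - permSum b (σ * Equiv.swap i j) =
      b i (σ i) + b j (σ j) - b i (σ j) - b j (σ i) := by
  rcases eq_or_ne i j with rfl | hij
  · rw [Equiv.swap_self, ← Equiv.Perm.one_def, mul_one]
    ring
  · rw [permSum, permSum, ← Finset.sum_sub_distrib, Fintype.sum_eq_add i j hij]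
    · simp
      ring
    · rintro k ⟨hi, hj⟩
      simp [Equiv.swap_apply_of_ne_of_ne hi hj]

theorem sum_sub_permSum_mul_swap [Nonempty α] (b : α → α → ℝ) (σ : Equiv.Perm α) :
    ∑ i, ∑ j, (permSum b σ - permSum b (σ * Equiv.swap i j)) =
      2 * Fintype.card α * (permSum b σ - permMean b) := by
  have h : ∑ i, ∑ j, b j (σ i) = ∑ i, ∑ k, b i k := by
    rw [Finset.sum_comm, sum_sum_apply_perm]
  simp only [permSum_sub_permSum_mul_swap, Finset.sum_sub_distrib, Finset.sum_add_distrib, h,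
    sum_sum_apply_perm, ← card_mul_permMean, Finset.sum_const, Finset.card_univ, nsmul_eq_mul,
    ← Finset.mul_sum]
  rw [permSum]
  ring

theorem sum_sub_permSum_mul_swap_sq_le [Nonempty α] {b : α → α → ℝ}
    (hb : ∀ i k, b i k ∈ Set.Icc (0 : ℝ) 1) (σ : Equiv.Perm α) :
    ∑ i, ∑ j, (permSum b σ - permSum b (σ * Equiv.swap i j)) ^ 2 ≤
      4 * Fintype.card α * (permSum b σ + permMean b) := by
  have hle : ∀ i j, (permSum b σ - permSum b (σ * Equiv.swap i j)) ^ 2 ≤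
      2 * (b i (σ i) + b j (σ j) + b i (σ j) + b j (σ i)) := by
    intro i j
    rw [permSum_sub_permSum_mul_swap]
    obtain ⟨h1, h1'⟩ := hb i (σ i)
    obtain ⟨h2, h2'⟩ := hb j (σ j)
    obtain ⟨h3, h3'⟩ := hb i (σ j)
    obtain ⟨h4, h4'⟩ := hb j (σ i)
    have hp : (b i (σ i) + b j (σ j)) ^ 2 ≤ 2 * (b i (σ i) + b j (σ j)) := by nlinarith
    have hq : (b i (σ j) + b j (σ i)) ^ 2 ≤ 2 * (b i (σ j) + b j (σ i)) := by nlinarith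
    nlinarith [mul_nonneg (add_nonneg h1 h2) (add_nonneg h3 h4)]
  refine (Finset.sum_le_sum fun i _ => Finset.sum_le_sum fun j _ => hle i j).trans_eq ?_
  have h : ∑ i, ∑ j, b j (σ i) = ∑ i, ∑ k, b i k := by
    rw [Finset.sum_comm, sum_sum_apply_perm]
  simp only [← Finset.mul_sum, Finset.sum_add_distrib, h, sum_sum_apply_perm,
    ← card_mul_permMean, Finset.sum_const, Finset.card_univ, nsmul_eq_mul]
  rw [permSum]
  ring

/-- Symmetrisation over the exchangeable pair `(σ, σ * swap i j)`. -/
theorem sum_exp_mul_sub_le (S : Equiv.Perm α → ℝ) (i j : α) (m : ℝ) {ε θ : ℝ} (hθ : 0 ≤ θ)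
    (hε : ε ^ 2 = 1) :
    ∑ σ, Real.exp (θ * (ε * (S σ - m))) * (ε * (S σ - S (σ * Equiv.swap i j))) ≤
      θ / 2 * ∑ σ, Real.exp (θ * (ε * (S σ - m))) * (S σ - S (σ * Equiv.swap i j)) ^ 2 := by
  have hswap : ∀ F : Equiv.Perm α → ℝ, ∑ σ, F (σ * Equiv.swap i j) = ∑ σ, F σ :=
    fun F => Equiv.sum_comp (Equiv.mulRight (Equiv.swap i j)) F
  have hcancel : ∀ σ : Equiv.Perm α, σ * Equiv.swap i j * Equiv.swap i j = σ := fun σ => by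
    simp [mul_assoc]
  have h1 := hswap fun σ =>
    Real.exp (θ * (ε * (S σ - m))) * (ε * (S σ - S (σ * Equiv.swap i j)))
  have h2 := hswap fun σ =>
    Real.exp (θ * (ε * (S σ - m))) * (S σ - S (σ * Equiv.swap i j)) ^ 2
  simp only [hcancel] at h1 h2
  have hle := Finset.sum_le_sum fun (σ : Equiv.Perm α) (_ : σ ∈ Finset.univ) =>
    exp_sub_exp_mul_le (x := θ * (ε * (S σ - m))) (y := θ * (ε * (S (σ * Equiv.swap i j) - m)))
      (w := ε * (S σ - S (σ * Equiv.swap i j))) hθ (by ring)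
  have hl : ∑ σ, (Real.exp (θ * (ε * (S σ - m))) -
      Real.exp (θ * (ε * (S (σ * Equiv.swap i j) - m)))) *
        (ε * (S σ - S (σ * Equiv.swap i j))) =
      2 * ∑ σ, Real.exp (θ * (ε * (S σ - m))) * (ε * (S σ - S (σ * Equiv.swap i j))) := by
    rw [two_mul]
    nth_rw 2 [← h1]
    rw [← Finset.sum_add_distrib]
    exact Finset.sum_congr rfl fun σ _ => by ring
  have hr : ∑ σ, θ / 2 * (ε * (S σ - S (σ * Equiv.swap i j))) ^ 2 *
      (Real.exp (θ * (ε * (S σ - m))) + Real.exp (θ * (ε * (S (σ * Equiv.swap i j) - m)))) =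
      2 * (θ / 2 * ∑ σ, Real.exp (θ * (ε * (S σ - m))) *
        (S σ - S (σ * Equiv.swap i j)) ^ 2) := by
    rw [two_mul]
    nth_rw 2 [← h2]
    rw [← mul_add, ← Finset.sum_add_distrib, Finset.mul_sum]
    refine Finset.sum_congr rfl fun σ _ => ?_
    rw [mul_pow, hε]
    ring
  rw [hl, hr] at hle
  linarith

theorem sum_exp_mul_permSum_sub_le [Nonempty α] {b : α → α → ℝ}
    (hb : ∀ i k, b i k ∈ Set.Icc (0 : ℝ) 1) {ε θ : ℝ} (hθ : 0 ≤ θ) (hε : ε ^ 2 = 1) :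
    ∑ σ, Real.exp (θ * (ε * (permSum b σ - permMean b))) *
        (ε * (permSum b σ - permMean b)) ≤
      θ * ∑ σ, Real.exp (θ * (ε * (permSum b σ - permMean b))) *
        (permSum b σ + permMean b) := by
  have hN : (0 : ℝ) < Fintype.card α := by exact_mod_cast Fintype.card_pos
  have h := Finset.sum_le_sum fun (i : α) (_ : i ∈ Finset.univ) =>
    Finset.sum_le_sum fun (j : α) (_ : j ∈ Finset.univ) =>
      sum_exp_mul_sub_le (permSum b) i j (permMean b) hθ hε
  have hl : ∑ i, ∑ j, ∑ σ, Real.exp (θ * (ε * (permSum b σ - permMean b))) *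
      (ε * (permSum b σ - permSum b (σ * Equiv.swap i j))) =
      2 * Fintype.card α * ∑ σ, Real.exp (θ * (ε * (permSum b σ - permMean b))) *
        (ε * (permSum b σ - permMean b)) := by
    simp_rw [Finset.sum_comm (t := (Finset.univ : Finset (Equiv.Perm α)))]
    rw [Finset.mul_sum]
    refine Finset.sum_congr rfl fun σ _ => ?_
    simp_rw [← Finset.mul_sum]
    rw [sum_sub_permSum_mul_swap]
    ring
  have hr : ∑ i, ∑ j, θ / 2 * ∑ σ, Real.exp (θ * (ε * (permSum b σ - permMean b))) *
      (permSum b σ - permSum b (σ * Equiv.swap i j)) ^ 2 ≤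
      θ / 2 * ∑ σ, Real.exp (θ * (ε * (permSum b σ - permMean b))) *
        (4 * Fintype.card α * (permSum b σ + permMean b)) := by
    simp_rw [← Finset.mul_sum]
    refine mul_le_mul_of_nonneg_left ?_ (by positivity)
    simp_rw [Finset.sum_comm (t := (Finset.univ : Finset (Equiv.Perm α)))]
    refine Finset.sum_le_sum fun σ _ => ?_
    simp_rw [← Finset.mul_sum]
    exact mul_le_mul_of_nonneg_left (sum_sub_permSum_mul_swap_sq_le hb σ) (Real.exp_pos _).le
  rw [hl] at h
  refine le_of_mul_le_mul_left ((h.trans hr).trans_eq ?_) (by positivity :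
    (0 : ℝ) < 2 * Fintype.card α)
  simp_rw [Finset.mul_sum]
  exact Finset.sum_congr rfl fun σ _ => by ring

/-- The differential inequality for the moment generating function. -/
theorem one_sub_mul_sum_exp_mul_le [Nonempty α] {b : α → α → ℝ}
    (hb : ∀ i k, b i k ∈ Set.Icc (0 : ℝ) 1) {ε θ : ℝ} (hθ : 0 ≤ θ) (hθ1 : θ ≤ 1)
    (hε : ε = 1 ∨ ε = -1) :
    (1 - θ) * ∑ σ, Real.exp (θ * (ε * (permSum b σ - permMean b))) *
        (ε * (permSum b σ - permMean b)) ≤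
      2 * permMean b * θ * ∑ σ, Real.exp (θ * (ε * (permSum b σ - permMean b))) := by
  have hε2 : ε ^ 2 = 1 := by rcases hε with rfl | rfl <;> norm_num
  have h := sum_exp_mul_permSum_sub_le hb hθ hε2
  have hsplit : ∑ σ, Real.exp (θ * (ε * (permSum b σ - permMean b))) *
      (permSum b σ + permMean b) =
      ε * ∑ σ, Real.exp (θ * (ε * (permSum b σ - permMean b))) *
        (ε * (permSum b σ - permMean b)) +
      2 * permMean b * ∑ σ, Real.exp (θ * (ε * (permSum b σ - permMean b))) := by
    rw [Finset.mul_sum, Finset.mul_sum, ← Finset.sum_add_distrib]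
    refine Finset.sum_congr rfl fun σ _ => ?_
    linear_combination (-Real.exp (θ * (ε * (permSum b σ - permMean b))) *
      (permSum b σ - permMean b)) * hε2
  rw [hsplit] at h
  have hM : 0 ≤ ∑ σ, Real.exp (θ * (ε * (permSum b σ - permMean b))) :=
    Finset.sum_nonneg fun σ _ => (Real.exp_pos _).le
  have hR := mul_nonneg (mul_nonneg (permMean_nonneg hb) hθ) hM
  generalize ∑ σ, Real.exp (θ * (ε * (permSum b σ - permMean b))) *
        (ε * (permSum b σ - permMean b)) = A at *
  rcases hε with rfl | rfl
  · linarith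
  · rcases le_total 0 A with hA | hA
    · nlinarith [mul_nonneg hθ hA]
    · nlinarith [mul_nonneg (sub_nonneg.2 hθ1) (neg_nonneg.2 hA)]

theorem sum_exp_le [Nonempty α] {b : α → α → ℝ}
    (hb : ∀ i k, b i k ∈ Set.Icc (0 : ℝ) 1) {ε θ : ℝ} (hθ : 0 ≤ θ) (hθ1 : θ < 1)
    (hε : ε = 1 ∨ ε = -1) :
    ∑ σ, Real.exp (θ * (ε * (permSum b σ - permMean b))) ≤
      Fintype.card (Equiv.Perm α) * Real.exp (permMean b / (1 - θ) * θ ^ 2) := by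
  set X : Equiv.Perm α → ℝ := fun σ => ε * (permSum b σ - permMean b) with hX
  set c := permMean b / (1 - θ) with hc
  have hd : ∀ x : ℝ, HasDerivAt (fun x => (∑ σ, Real.exp (x * X σ)) * Real.exp (-(c * x ^ 2)))
      (((∑ σ, Real.exp (x * X σ) * X σ) - 2 * c * x * ∑ σ, Real.exp (x * X σ)) *
        Real.exp (-(c * x ^ 2))) x := by
    intro x
    have h1 : HasDerivAt (fun x => ∑ σ, Real.exp (x * X σ))
        (∑ σ, Real.exp (x * X σ) * X σ) x :=
      HasDerivAt.fun_sum fun σ _ => by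
        simpa using ((hasDerivAt_id x).mul_const (X σ)).exp
    have h2 : HasDerivAt (fun x => Real.exp (-(c * x ^ 2)))
        (Real.exp (-(c * x ^ 2)) * (-(c * (2 * x)))) x := by
      simpa using (((hasDerivAt_pow 2 x).const_mul c).neg).exp
    exact (h1.fun_mul h2).congr_deriv (by ring)
  have hanti : AntitoneOn (fun x => (∑ σ, Real.exp (x * X σ)) * Real.exp (-(c * x ^ 2)))
      (Set.Icc 0 θ) := by
    refine antitoneOn_of_deriv_nonpos (convex_Icc 0 θ)
      (fun x _ => (hd x).continuousAt.continuousWithinAt)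
      (fun x _ => (hd x).differentiableAt.differentiableWithinAt) fun x hx => ?_
    rw [interior_Icc] at hx
    rw [(hd x).deriv]
    refine mul_nonpos_of_nonpos_of_nonneg ?_ (Real.exp_pos _).le
    have hx1 : 0 < 1 - x := by linarith [hx.2]
    have hM : 0 ≤ ∑ σ, Real.exp (x * X σ) := Finset.sum_nonneg fun σ _ => (Real.exp_pos _).le
    have h := one_sub_mul_sum_exp_mul_le hb hx.1.le (by linarith) hε
    have hcle : permMean b ≤ (1 - x) * c := by
      have hcn : 0 ≤ c := div_nonneg (permMean_nonneg hb) (by linarith)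
      have : (1 - θ) * c = permMean b := by
        rw [hc]; field_simp [(sub_pos.2 hθ1).ne']
      nlinarith [hx.2]
    have h' := mul_le_mul_of_nonneg_right hcle (mul_nonneg hx.1.le hM)
    refine nonpos_of_mul_nonpos_right (a := 1 - x) ?_ hx1
    change (1 - x) * ∑ σ, Real.exp (x * X σ) * X σ ≤ _ at h
    nlinarith
  have h := hanti (Set.left_mem_Icc.2 hθ) (Set.right_mem_Icc.2 hθ) hθ
  simp only [zero_mul, Real.exp_zero, Finset.sum_const, Finset.card_univ, nsmul_eq_mul, mul_one,
    ne_eq, OfNat.ofNat_ne_zero, not_false_eq_true, zero_pow, mul_zero, neg_zero] at h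
  rwa [Real.exp_neg, ← div_eq_mul_inv, div_le_iff₀ (Real.exp_pos _)] at h

/-- One-sided Bernstein-type tail bound; the sign `ε` selects the upper or the lower tail. -/
theorem card_filter_le_permSum [Nonempty α] {b : α → α → ℝ}
    (hb : ∀ i k, b i k ∈ Set.Icc (0 : ℝ) 1) {ε s : ℝ} (hs : 0 < s) (hε : ε = 1 ∨ ε = -1) :
    ((Finset.univ.filter fun σ => s ≤ ε * (permSum b σ - permMean b)).card : ℝ) ≤
      Fintype.card (Equiv.Perm α) * Real.exp (-s ^ 2 / (2 * (2 * permMean b + s))) := by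
  rcases (permMean_nonneg hb).eq_or_lt with h0 | hpos
  · have hzero : ∀ σ, permSum b σ = 0 := by
      intro σ
      refine le_antisymm ?_ (Finset.sum_nonneg fun i _ => (hb i (σ i)).1)
      calc permSum b σ ≤ ∑ i, ∑ k, b i k := Finset.sum_le_sum fun i _ =>
            Finset.single_le_sum (fun k _ => (hb i k).1) (Finset.mem_univ (σ i))
        _ = 0 := by rw [← card_mul_permMean, ← h0, mul_zero]
    rw [Finset.filter_false_of_mem fun σ _ => by simp [hzero, ← h0, hs]]
    simp only [Finset.card_empty, Nat.cast_zero]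
    positivity
  · set m := permMean b with hm
    set θ := s / (2 * m + s) with hθ
    have hθ0 : 0 ≤ θ := by positivity
    have hθ1 : θ < 1 := by rw [hθ, div_lt_one (by positivity)]; linarith
    have h := sum_exp_le hb hθ0 hθ1 hε
    have hmarkov : ((Finset.univ.filter fun σ => s ≤ ε * (permSum b σ - m)).card : ℝ) *
        Real.exp (θ * s) ≤ ∑ σ, Real.exp (θ * (ε * (permSum b σ - m))) := by
      rw [← nsmul_eq_mul]
      refine (Finset.card_nsmul_le_sum _ _ _ fun σ hσ => ?_).trans
        (Finset.sum_le_univ_sum_of_nonneg fun σ => (Real.exp_pos _).le)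
      exact Real.exp_le_exp.2 (mul_le_mul_of_nonneg_left (Finset.mem_filter.1 hσ).2 hθ0)
    have hexp : m / (1 - θ) * θ ^ 2 = -s ^ 2 / (2 * (2 * m + s)) + θ * s := by
      have h1 : 1 - θ = 2 * m / (2 * m + s) := by rw [hθ]; field_simp; ring
      rw [h1, hθ]
      field_simp
      ring
    have h' := hmarkov.trans h
    rw [← hm, hexp, Real.exp_add, ← mul_assoc] at h'
    exact le_of_mul_le_mul_right h' (Real.exp_pos _)

/-- Chatterjee's Bernstein-type inequality for sums along a uniform random permutation. -/
theorem card_filter_le_abs_permSum [Nonempty α] {b : α → α → ℝ}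
    (hb : ∀ i k, b i k ∈ Set.Icc (0 : ℝ) 1) {s : ℝ} (hs : 0 < s) :
    ((Finset.univ.filter fun σ => s ≤ |permSum b σ - permMean b|).card : ℝ) /
      (Fintype.card (Equiv.Perm α) : ℝ) ≤
      2 * Real.exp (-s ^ 2 / (2 * (2 * permMean b + s))) := by
  have hN : (0 : ℝ) < Fintype.card (Equiv.Perm α) := by exact_mod_cast Fintype.card_pos
  have h1 := card_filter_le_permSum hb hs (Or.inl rfl)
  have h2 := card_filter_le_permSum hb hs (Or.inr rfl)
  rw [div_le_iff₀ hN]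
  have hunion : ((Finset.univ.filter fun σ => s ≤ |permSum b σ - permMean b|).card : ℝ) ≤
      (Finset.univ.filter fun σ => s ≤ 1 * (permSum b σ - permMean b)).card +
      (Finset.univ.filter fun σ => s ≤ -1 * (permSum b σ - permMean b)).card := by
    simp_rw [le_abs, one_mul, neg_one_mul, Finset.filter_or]
    exact_mod_cast Finset.card_union_le _ _
  linarith

end PermutationSum

/-- Bernstein-type concentration for `T₁ = ∑ i, ∑ j, a i j (σ i)` with `σ` uniform on
permutations of `Fin n`, where `μ₁ = (∑ i, ∑ j, ∑ k, a i j k) / n = E[T₁]`. -/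
theorem T1_concentration
    (n : ℕ) (hn : 0 < n) (a : Fin n → Fin n → Fin n → ℝ)
    (ha : ∀ i j k, a i j k ∈ Set.Icc (0 : ℝ) 1) (t : ℝ) (ht : 0 < t) :
    ((Finset.univ.filter fun σ : Equiv.Perm (Fin n) =>
        t ≤ |(∑ i, ∑ j, a i j (σ i)) - (∑ i, ∑ j, ∑ k, a i j k) / n|).card : ℝ) /
      (Fintype.card (Equiv.Perm (Fin n)) : ℝ) ≤
    2 * Real.exp (-t ^ 2 /
      (2 * n * (2 * ((∑ i, ∑ j, ∑ k, a i j k) / n) + t))) := by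
  have hn' : (0 : ℝ) < n := by exact_mod_cast hn
  have : Nonempty (Fin n) := ⟨⟨0, hn⟩⟩
  set b : Fin n → Fin n → ℝ := fun i k => (∑ j, a i j k) / n with hb_def
  have hb : ∀ i k, b i k ∈ Set.Icc (0 : ℝ) 1 := by
    intro i k
    refine ⟨div_nonneg (Finset.sum_nonneg fun j _ => (ha i j k).1) hn'.le, ?_⟩
    rw [hb_def, div_le_one hn']
    simpa using Finset.sum_le_sum fun (j : Fin n) (_ : j ∈ Finset.univ) => (ha i j k).2
  have hsum : ∀ σ : Equiv.Perm (Fin n), ∑ i, ∑ j, a i j (σ i) = n * permSum b σ := by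
    intro σ
    rw [permSum, hb_def, ← Finset.sum_div]
    field_simp
  have hmean : (∑ i, ∑ j, ∑ k, a i j k) / n = n * permMean b := by
    have hcomm : ∑ i, ∑ j, ∑ k, a i j k = ∑ i, ∑ k, ∑ j, a i j k :=
      Finset.sum_congr rfl fun i _ => Finset.sum_comm
    simp only [permMean, hb_def, ← Finset.sum_div, Fintype.card_fin, hcomm]
    field_simp
  have key := card_filter_le_abs_permSum hb (div_pos ht hn')
  have hiff : ∀ σ : Equiv.Perm (Fin n), t ≤ |n * permSum b σ - n * permMean b| ↔
      t / n ≤ |permSum b σ - permMean b| := by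
    intro σ
    rw [← mul_sub, abs_mul, abs_of_pos hn', div_le_iff₀' hn']
  have hexp : -t ^ 2 / (2 * n * (2 * (n * permMean b) + t)) =
      -(t / n) ^ 2 / (2 * (2 * permMean b + t / n)) := by
    have hm := permMean_nonneg hb
    field_simp
  simp_rw [hmean, hsum, hiff]
  rw [hexp]
  convert key using 4
end

section
/- There exist constants K > 0 and N ≥ 3 such that for every integer n ≥ N, every 3-dimensional array a : [n]×[n]×[n] → [0,1], and every t ≥ 3 + K/n, one has P(|T2 − μ2| ≥ t) ≤ 2·exp(−(t − 3 − K/n)² / (12·μ2 + 18 + 6·(1 + K/n)·(t − 3))), where T2 = Σ_{i=1}^n a_{i,σ(i),π(i)} for σ, π independent uniformly random permutations of [n]. -/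
open scoped Classical

/-- The trapezoid bound for the increments of the exponential function. -/
lemma sub_mul_exp_sub_exp_le (x y : ℝ) :
    (x - y) * (Real.exp x - Real.exp y) ≤
      (x - y) ^ 2 * (Real.exp x + Real.exp y) / 2 := by
  have key : ∀ d : ℝ, 0 ≤ d → 2 * (Real.exp d - 1) ≤ d * (Real.exp d + 1) := by
    intro d hd
    have hderiv : ∀ x : ℝ, HasDerivAt (fun d : ℝ => d * (Real.exp d + 1) - 2 * (Real.exp d - 1))
        (1 * (Real.exp x + 1) + x * Real.exp x - 2 * Real.exp x) x := fun x =>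
      ((hasDerivAt_id x).mul ((Real.hasDerivAt_exp x).add_const 1)).sub
        (((Real.hasDerivAt_exp x).sub_const 1).const_mul 2)
    have hmono : Monotone (fun d : ℝ => d * (Real.exp d + 1) - 2 * (Real.exp d - 1)) := by
      refine monotone_of_hasDerivAt_nonneg hderiv fun x => ?_
      have h1 := Real.add_one_le_exp (-x)
      have h2 : Real.exp (-x) * Real.exp x = 1 := by rw [← Real.exp_add]; simp
      have h3 := mul_le_mul_of_nonneg_right h1 (Real.exp_pos x).le
      simp only [Pi.zero_apply]
      linarith
    have h := hmono hd
    simp only [Real.exp_zero] at h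
    linarith
  have ordered : ∀ x y : ℝ, y ≤ x → (x - y) * (Real.exp x - Real.exp y) ≤
      (x - y) ^ 2 * (Real.exp x + Real.exp y) / 2 := by
    intro x y hxy
    have hd : 0 ≤ x - y := sub_nonneg.2 hxy
    have hx : Real.exp x = Real.exp (x - y) * Real.exp y := by rw [← Real.exp_add]; simp
    have h := mul_le_mul_of_nonneg_left (key (x - y) hd)
      (mul_nonneg hd (Real.exp_pos y).le)
    rw [hx]
    linarith
  rcases le_total y x with h | h
  · exact ordered x y h
  · have := ordered y x h
    linarith

/-- Derivative of an unnormalised moment generating function. -/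
lemma hasDerivAt_sum_exp_mul {α : Type*} [Fintype α] (T : α → ℝ) (θ : ℝ) :
    HasDerivAt (fun s => ∑ x, Real.exp (s * T x)) (∑ x, T x * Real.exp (θ * T x)) θ := by
  refine HasDerivAt.fun_sum fun x _ => ?_
  simpa [mul_comm] using ((hasDerivAt_id θ).mul_const (T x)).exp

/-- A Grönwall inequality on `[0, θ]`. -/
lemma le_mul_exp_of_hasDerivAt_le {M M' g g' : ℝ → ℝ} {θ : ℝ} (hθ : 0 ≤ θ)
    (hM : ∀ s ∈ Set.Icc 0 θ, HasDerivAt M (M' s) s)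
    (hg : ∀ s ∈ Set.Icc 0 θ, HasDerivAt g (g' s) s)
    (hle : ∀ s ∈ Set.Ioo 0 θ, M' s ≤ g' s * M s) (hg0 : g 0 = 0) :
    M θ ≤ M 0 * Real.exp (g θ) := by
  have hd : ∀ s ∈ Set.Icc 0 θ, HasDerivAt (fun s => M s * Real.exp (-g s))
      (M' s * Real.exp (-g s) + M s * (Real.exp (-g s) * -g' s)) s := fun s hs =>
    (hM s hs).mul (hg s hs).neg.exp
  have hanti : AntitoneOn (fun s => M s * Real.exp (-g s)) (Set.Icc 0 θ) := by
    refine antitoneOn_of_deriv_nonpos (convex_Icc 0 θ)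
      (fun s hs => (hd s hs).continuousAt.continuousWithinAt)
      (fun s hs => (hd s (interior_subset hs)).differentiableAt.differentiableWithinAt)
      fun s hs => ?_
    rw [(hd s (interior_subset hs)).deriv]
    have := mul_le_mul_of_nonneg_right (hle s (interior_Icc.subset hs)) (Real.exp_pos (-g s)).le
    linarith
  have h := hanti (Set.left_mem_Icc.2 hθ) (Set.right_mem_Icc.2 hθ) hθ
  simp only [hg0, neg_zero, Real.exp_zero, mul_one] at h
  have h2 : Real.exp (-g θ) * Real.exp (g θ) = 1 := by rw [← Real.exp_add]; simp
  calc M θ = M θ * Real.exp (-g θ) * Real.exp (g θ) := by rw [mul_assoc, h2, mul_one]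
    _ ≤ M 0 * Real.exp (g θ) := mul_le_mul_of_nonneg_right h (Real.exp_pos _).le

/-- The average of numbers in `[0, 1]` lies in `[0, 1]`. -/
lemma average_mem_Icc {ι : Type*} [Fintype ι] {f : ι → ℝ} (hf : ∀ k, f k ∈ Set.Icc (0 : ℝ) 1) :
    (∑ k, f k) / Fintype.card ι ∈ Set.Icc (0 : ℝ) 1 := by
  refine ⟨div_nonneg (Finset.sum_nonneg fun k _ => (hf k).1) (Nat.cast_nonneg _),
    div_le_one_of_le₀ ?_ (Nat.cast_nonneg _)⟩
  simpa using Finset.sum_le_sum fun k (_ : k ∈ Finset.univ) => (hf k).2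

section Permutation

variable {ι : Type*} [Fintype ι] [DecidableEq ι]

/-- Composing a permutation with a transposition changes at most two terms of `∑ i, a i (π i)`. -/
lemma sum_apply_sub_sum_apply_mul_swap (a : ι → ι → ℝ) (π : Equiv.Perm ι) (i j : ι) :
    ∑ k, a k (π k) - ∑ k, a k ((π * Equiv.swap i j) k) =
      a i (π i) + a j (π j) - a i (π j) - a j (π i) := by
  rcases eq_or_ne i j with rfl | hij
  · simp
  · rw [← Finset.sum_sub_distrib, ← Finset.sum_subset (Finset.subset_univ {i, j}),
      Finset.sum_pair hij]
    · simp only [Equiv.Perm.mul_apply, Equiv.swap_apply_left, Equiv.swap_apply_right]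
      ring
    · intro k _ hk
      simp only [Finset.mem_insert, Finset.mem_singleton, not_or] at hk
      simp [Equiv.Perm.mul_apply, Equiv.swap_apply_of_ne_of_ne hk.1 hk.2]

/-- The exchangeable pair inequality `θ E[(T - μ) exp (θ T)] ≤ θ² E[(T + μ) exp (θ T)]` for
`T = ∑ i, a i (π i)` with `π` a uniform permutation. -/
lemma sum_perm_sub_mul_exp_le [Nonempty ι] (a : ι → ι → ℝ)
    (ha : ∀ i j, a i j ∈ Set.Icc (0 : ℝ) 1) (μ : ℝ)
    (hμ : ∑ i, ∑ j, a i j = Fintype.card ι * μ) (θ : ℝ) :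
    θ * ∑ π : Equiv.Perm ι, (∑ i, a i (π i) - μ) * Real.exp (θ * ∑ i, a i (π i)) ≤
      θ ^ 2 * ∑ π : Equiv.Perm ι,
        (∑ i, a i (π i) + μ) * Real.exp (θ * ∑ i, a i (π i)) := by
  set T : Equiv.Perm ι → ℝ := fun π => ∑ i, a i (π i) with hT
  set E : Equiv.Perm ι → ℝ := fun π => Real.exp (θ * T π) with hE
  have hn : (0 : ℝ) < Fintype.card ι := by exact_mod_cast Fintype.card_pos
  have hrow (π : Equiv.Perm ι) : ∑ i, ∑ j, a i (π j) = Fintype.card ι * μ := by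
    rw [← hμ]
    exact Finset.sum_congr rfl fun i _ => Equiv.sum_comp π (a i)
  have hdiff (π : Equiv.Perm ι) :
      ∑ i, ∑ j, (T π - T (π * Equiv.swap i j)) = 2 * Fintype.card ι * (T π - μ) := by
    simp only [hT, sum_apply_sub_sum_apply_mul_swap, Finset.sum_sub_distrib,
      Finset.sum_add_distrib]
    rw [Finset.sum_comm (f := fun i j => a j (π i)), hrow]
    simp only [Finset.sum_const, Finset.card_univ, nsmul_eq_mul, ← Finset.mul_sum]
    ring
  have hsq (π : Equiv.Perm ι) :
      ∑ i, ∑ j, (T π - T (π * Equiv.swap i j)) ^ 2 ≤ 4 * Fintype.card ι * (T π + μ) := by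
    have hsum : ∑ i, ∑ j, 2 * (a i (π i) + a j (π j) + a i (π j) + a j (π i)) =
        4 * Fintype.card ι * (T π + μ) := by
      simp only [hT, ← Finset.mul_sum, Finset.sum_add_distrib]
      rw [Finset.sum_comm (f := fun i j => a j (π i)), hrow]
      simp only [Finset.sum_const, Finset.card_univ, nsmul_eq_mul, ← Finset.mul_sum]
      ring
    rw [← hsum]
    refine Finset.sum_le_sum fun i _ => Finset.sum_le_sum fun j _ => ?_
    simp only [hT, sum_apply_sub_sum_apply_mul_swap]
    obtain ⟨h1, h1'⟩ := ha i (π i)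
    obtain ⟨h2, h2'⟩ := ha j (π j)
    obtain ⟨h3, h3'⟩ := ha i (π j)
    obtain ⟨h4, h4'⟩ := ha j (π i)
    have hx : 0 ≤ a i (π i) + a j (π j) := by linarith
    have hy : 0 ≤ a i (π j) + a j (π i) := by linarith
    have := mul_nonneg hx hy
    have := mul_nonneg hx (by linarith : 0 ≤ 2 - (a i (π i) + a j (π j)))
    have := mul_nonneg hy (by linarith : 0 ≤ 2 - (a i (π j) + a j (π i)))
    linarith
  have hpair (i j : ι) :
      θ * ∑ π, (T π - T (π * Equiv.swap i j)) * E π ≤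
        θ ^ 2 / 2 * ∑ π, (T π - T (π * Equiv.swap i j)) ^ 2 * E π := by
    have hinv (π : Equiv.Perm ι) : π * Equiv.swap i j * Equiv.swap i j = π := by
      rw [mul_assoc, Equiv.swap_mul_self, mul_one]
    have hsymm (f : Equiv.Perm ι → Equiv.Perm ι → ℝ) :
        ∑ π, f π (π * Equiv.swap i j) = ∑ π, f (π * Equiv.swap i j) π := by
      rw [← Equiv.sum_comp (Equiv.mulRight (Equiv.swap i j))]
      simp [hinv]
    have h1 := hsymm fun π ρ => (T π - T ρ) * E π
    have h2 := hsymm fun π ρ => (T π - T ρ) ^ 2 * E π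
    have h3 : ∑ π, θ * ((T π - T (π * Equiv.swap i j)) * E π +
          (T (π * Equiv.swap i j) - T π) * E (π * Equiv.swap i j)) ≤
        ∑ π, θ ^ 2 / 2 * ((T π - T (π * Equiv.swap i j)) ^ 2 * E π +
          (T (π * Equiv.swap i j) - T π) ^ 2 * E (π * Equiv.swap i j)) := by
      refine Finset.sum_le_sum fun π _ => ?_
      have h := sub_mul_exp_sub_exp_le (θ * T π) (θ * T (π * Equiv.swap i j))
      simp only [hE]
      linarith
    rw [← Finset.mul_sum, ← Finset.mul_sum, Finset.sum_add_distrib, Finset.sum_add_distrib,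
      ← h1, ← h2] at h3
    linarith
  have hleft : ∑ i, ∑ j, θ * ∑ π, (T π - T (π * Equiv.swap i j)) * E π =
      2 * Fintype.card ι * (θ * ∑ π, (T π - μ) * E π) := by
    simp only [← Finset.mul_sum]
    rw [Finset.sum_congr rfl fun i _ => Finset.sum_comm, Finset.sum_comm]
    simp only [← Finset.sum_mul, hdiff, mul_assoc, ← Finset.mul_sum]
    ring
  have hright : ∑ i, ∑ j, θ ^ 2 / 2 * ∑ π, (T π - T (π * Equiv.swap i j)) ^ 2 * E π ≤
      2 * Fintype.card ι * (θ ^ 2 * ∑ π, (T π + μ) * E π) := by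
    simp only [← Finset.mul_sum]
    rw [Finset.sum_congr rfl fun i _ => Finset.sum_comm, Finset.sum_comm]
    simp only [← Finset.sum_mul]
    have h : ∑ π, (∑ i, ∑ j, (T π - T (π * Equiv.swap i j)) ^ 2) * E π ≤
        ∑ π, 4 * Fintype.card ι * (T π + μ) * E π :=
      Finset.sum_le_sum fun π _ => mul_le_mul_of_nonneg_right (hsq π) (Real.exp_pos _).le
    simp only [mul_assoc, ← Finset.mul_sum] at h
    have := mul_le_mul_of_nonneg_left h (by positivity : 0 ≤ θ ^ 2 / 2)
    linarith
  have h := (hleft.symm.le.trans (Finset.sum_le_sum fun i _ =>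
    Finset.sum_le_sum fun j _ => hpair i j)).trans hright
  exact le_of_mul_le_mul_left h (by positivity)

/-- Upper-tail moment generating function bound for `∑ i, a i (π i)`. -/
lemma sum_perm_exp_le [Nonempty ι] (a : ι → ι → ℝ)
    (ha : ∀ i j, a i j ∈ Set.Icc (0 : ℝ) 1) (μ : ℝ)
    (hμ : ∑ i, ∑ j, a i j = Fintype.card ι * μ) (hμ0 : 0 ≤ μ) {θ : ℝ} (hθ : 0 ≤ θ)
    (hθ1 : θ < 1) :
    ∑ π : Equiv.Perm ι, Real.exp (θ * ∑ i, a i (π i)) ≤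
      Fintype.card (Equiv.Perm ι) * Real.exp (μ * (θ / (1 - θ))) := by
  have h := le_mul_exp_of_hasDerivAt_le
    (g := fun s => μ * (s / (1 - s))) (g' := fun s => μ * (1 / (1 - s) ^ 2)) hθ
    (fun s _ => hasDerivAt_sum_exp_mul (fun π : Equiv.Perm ι => ∑ i, a i (π i)) s)
    (fun s hs => ?_) (fun s hs => ?_) (by simp)
  · simpa using h
  · have h1 : 1 - s ≠ 0 := by linarith [hs.2]
    have := ((hasDerivAt_id s).div ((hasDerivAt_id s).const_sub 1) h1).const_mul μ
    simpa using this
  · have hs0 : 0 < s := hs.1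
    have hs1 : 0 < 1 - s := by linarith [hs.2]
    have h := sum_perm_sub_mul_exp_le a ha μ hμ s
    simp only [sub_mul, add_mul, Finset.sum_sub_distrib, Finset.sum_add_distrib,
      ← Finset.mul_sum] at h
    set M := ∑ π : Equiv.Perm ι, Real.exp (s * ∑ i, a i (π i))
    set D := ∑ π : Equiv.Perm ι, (∑ i, a i (π i)) * Real.exp (s * ∑ i, a i (π i))
    have hM : 0 ≤ M := Finset.sum_nonneg fun π _ => (Real.exp_pos _).le
    have hμM : 0 ≤ μ * M := mul_nonneg hμ0 hM
    have h' : D - μ * M ≤ s * (D + μ * M) := by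
      refine le_of_mul_le_mul_left ?_ hs0
      linarith
    rw [mul_one_div, div_mul_eq_mul_div, le_div_iff₀ (by positivity)]
    nlinarith [mul_le_mul_of_nonneg_left h' hs1.le, mul_nonneg (mul_nonneg hs0.le hs0.le) hμM]

/-- Lower-tail moment generating function bound for `∑ i, a i (π i)`. -/
lemma sum_perm_exp_neg_le [Nonempty ι] (a : ι → ι → ℝ)
    (ha : ∀ i j, a i j ∈ Set.Icc (0 : ℝ) 1) (μ : ℝ)
    (hμ : ∑ i, ∑ j, a i j = Fintype.card ι * μ) (hμ0 : 0 ≤ μ) {θ : ℝ} (hθ : 0 ≤ θ) :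
    ∑ π : Equiv.Perm ι, Real.exp (-θ * ∑ i, a i (π i)) ≤
      Fintype.card (Equiv.Perm ι) * Real.exp (μ * (θ ^ 2 - θ)) := by
  have h := le_mul_exp_of_hasDerivAt_le
    (g := fun s => μ * (s ^ 2 - s)) (g' := fun s => μ * (2 * s - 1)) hθ
    (fun s _ => hasDerivAt_sum_exp_mul (fun π : Equiv.Perm ι => -∑ i, a i (π i)) s)
    (fun s hs => ?_) (fun s hs => ?_) (by simp)
  · simpa using h
  · simpa using ((hasDerivAt_pow 2 s).sub (hasDerivAt_id s)).const_mul μ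
  · have hs0 : 0 < s := hs.1
    have h := sum_perm_sub_mul_exp_le a ha μ hμ (-s)
    simp only [sub_mul, add_mul, Finset.sum_sub_distrib, Finset.sum_add_distrib,
      ← Finset.mul_sum] at h
    simp only [mul_neg, neg_mul, Finset.sum_neg_distrib] at h ⊢
    set M := ∑ π : Equiv.Perm ι, Real.exp (-(s * ∑ i, a i (π i)))
    set D := ∑ π : Equiv.Perm ι, (∑ i, a i (π i)) * Real.exp (-(s * ∑ i, a i (π i)))
    have hM : 0 ≤ M := Finset.sum_nonneg fun π _ => (Real.exp_pos _).le
    have hμM : 0 ≤ μ * M := mul_nonneg hμ0 hM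
    have h' : μ * M - D ≤ s * (D + μ * M) := by
      refine le_of_mul_le_mul_left ?_ hs0
      linarith
    refine le_of_mul_le_mul_left ?_ (by linarith : 0 < 1 + s)
    nlinarith [mul_nonneg (mul_nonneg hs0.le hs0.le) hμM]

/-- Upper-tail moment generating function bound for `∑ i, a i (σ i) (π i)`. -/
lemma sum_perm_prod_exp_le [Nonempty ι] (a : ι → ι → ι → ℝ)
    (ha : ∀ i j k, a i j k ∈ Set.Icc (0 : ℝ) 1) (μ : ℝ)
    (hμ : ∑ i, ∑ j, ∑ k, a i j k = (Fintype.card ι : ℝ) ^ 2 * μ) (hμ0 : 0 ≤ μ)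
    {θ : ℝ} (hθ : 0 ≤ θ) (hθ1 : θ < 1 / 2) :
    ∑ p : Equiv.Perm ι × Equiv.Perm ι, Real.exp (θ * ∑ i, a i (p.1 i) (p.2 i)) ≤
      Fintype.card (Equiv.Perm ι × Equiv.Perm ι) * Real.exp (μ * (θ / (1 - 2 * θ))) := by
  have hn : (Fintype.card ι : ℝ) ≠ 0 := by exact_mod_cast Fintype.card_ne_zero
  set c : ι → ι → ℝ := fun i j => (∑ k, a i j k) / Fintype.card ι with hc
  have hc01 (i j : ι) : c i j ∈ Set.Icc (0 : ℝ) 1 := average_mem_Icc (ha i j)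
  have hθ' : 0 < 1 - θ := by linarith
  have hθ'' : 0 < 1 - 2 * θ := by linarith
  have hinner (σ : Equiv.Perm ι) := sum_perm_exp_le (fun i k => a i (σ i) k)
    (fun i k => ha i (σ i) k) (∑ i, c i (σ i))
    (by simp only [hc, ← Finset.sum_div]; field_simp)
    (Finset.sum_nonneg fun i _ => (hc01 i (σ i)).1) hθ (by linarith)
  have houter := sum_perm_exp_le c hc01 μ
    (by simp only [hc, ← Finset.sum_div, hμ]; field_simp) hμ0
    (div_nonneg hθ hθ'.le) ((div_lt_one hθ').2 (by linarith))
  have hφ : θ / (1 - θ) / (1 - θ / (1 - θ)) = θ / (1 - 2 * θ) := by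
    have : 1 - θ / (1 - θ) = (1 - 2 * θ) / (1 - θ) := by field_simp; ring
    rw [this]
    field_simp
  rw [hφ] at houter
  rw [Fintype.sum_prod_type, Fintype.card_prod, Nat.cast_mul, mul_assoc]
  refine (Finset.sum_le_sum fun σ _ => hinner σ).trans ?_
  rw [← Finset.mul_sum]
  simp only [mul_comm _ (θ / (1 - θ))] at houter ⊢
  exact mul_le_mul_of_nonneg_left houter (Nat.cast_nonneg _)

/-- Lower-tail moment generating function bound for `∑ i, a i (σ i) (π i)`. -/
lemma sum_perm_prod_exp_neg_le [Nonempty ι] (a : ι → ι → ι → ℝ)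
    (ha : ∀ i j k, a i j k ∈ Set.Icc (0 : ℝ) 1) (μ : ℝ)
    (hμ : ∑ i, ∑ j, ∑ k, a i j k = (Fintype.card ι : ℝ) ^ 2 * μ) (hμ0 : 0 ≤ μ)
    {θ : ℝ} (hθ : 0 ≤ θ) (hθ1 : θ ≤ 1) :
    ∑ p : Equiv.Perm ι × Equiv.Perm ι, Real.exp (-θ * ∑ i, a i (p.1 i) (p.2 i)) ≤
      Fintype.card (Equiv.Perm ι × Equiv.Perm ι) * Real.exp (μ * (2 * θ ^ 2 - θ)) := by
  have hn : (Fintype.card ι : ℝ) ≠ 0 := by exact_mod_cast Fintype.card_ne_zero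
  set c : ι → ι → ℝ := fun i j => (∑ k, a i j k) / Fintype.card ι with hc
  have hc01 (i j : ι) : c i j ∈ Set.Icc (0 : ℝ) 1 := average_mem_Icc (ha i j)
  have hinner (σ : Equiv.Perm ι) := sum_perm_exp_neg_le (fun i k => a i (σ i) k)
    (fun i k => ha i (σ i) k) (∑ i, c i (σ i))
    (by simp only [hc, ← Finset.sum_div]; field_simp)
    (Finset.sum_nonneg fun i _ => (hc01 i (σ i)).1) hθ
  have hψ : 0 ≤ θ - θ ^ 2 := by nlinarith
  have houter := sum_perm_exp_neg_le c hc01 μ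
    (by simp only [hc, ← Finset.sum_div, hμ]; field_simp) hμ0 hψ
  rw [Fintype.sum_prod_type, Fintype.card_prod, Nat.cast_mul, mul_assoc]
  refine (Finset.sum_le_sum fun σ _ => hinner σ).trans ?_
  rw [← Finset.mul_sum]
  simp only [neg_sub, mul_comm _ (θ ^ 2 - θ)] at houter ⊢
  refine mul_le_mul_of_nonneg_left (houter.trans ?_) (Nat.cast_nonneg _)
  refine mul_le_mul_of_nonneg_left (Real.exp_le_exp.2
    (mul_le_mul_of_nonneg_left ?_ hμ0)) (Nat.cast_nonneg _)
  nlinarith [mul_nonneg hθ (mul_nonneg hθ hθ), mul_nonneg (mul_nonneg hθ hθ) hψ]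

/-- Bernstein-type tail bound for `∑ i, a i (σ i) (π i)`. -/
lemma card_abs_sub_ge_le [Nonempty ι] (a : ι → ι → ι → ℝ)
    (ha : ∀ i j k, a i j k ∈ Set.Icc (0 : ℝ) 1) (μ : ℝ)
    (hμ : ∑ i, ∑ j, ∑ k, a i j k = (Fintype.card ι : ℝ) ^ 2 * μ) (hμ0 : 0 ≤ μ)
    {t : ℝ} (ht : 0 < t) :
    ((Finset.univ.filter fun p : Equiv.Perm ι × Equiv.Perm ι =>
        t ≤ |(∑ i, a i (p.1 i) (p.2 i)) - μ|).card : ℝ) ≤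
      Fintype.card (Equiv.Perm ι × Equiv.Perm ι) *
        (2 * Real.exp (-t ^ 2 / (8 * μ + 4 * t))) := by
  obtain ⟨θ, hθ, hθ1, hopt⟩ : ∃ θ : ℝ, 0 ≤ θ ∧ θ < 1 / 2 ∧
      μ * (θ / (1 - 2 * θ)) - θ * μ - θ * t ≤ -t ^ 2 / (8 * μ + 4 * t) := by
    rcases hμ0.eq_or_lt with rfl | hpos
    · refine ⟨1 / 4, by norm_num, by norm_num, le_of_eq ?_⟩
      field_simp
      ring
    · refine ⟨t / (4 * μ + 2 * t), by positivity, ?_, le_of_eq ?_⟩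
      · rw [div_lt_iff₀ (by positivity)]
        linarith
      · have : 1 - 2 * (t / (4 * μ + 2 * t)) = 4 * μ / (4 * μ + 2 * t) := by
          field_simp
          ring
        rw [this]
        field_simp
        ring
  have hθ2 : 0 < 1 - 2 * θ := by linarith
  have hupper := sum_perm_prod_exp_le a ha μ hμ hμ0 hθ hθ1
  have hlower := sum_perm_prod_exp_neg_le a ha μ hμ hμ0 hθ (by linarith)
  set T : Equiv.Perm ι × Equiv.Perm ι → ℝ := fun p => ∑ i, a i (p.1 i) (p.2 i)
  set R := Real.exp (-t ^ 2 / (8 * μ + 4 * t))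
  have hcard : (0 : ℝ) ≤ Fintype.card (Equiv.Perm ι × Equiv.Perm ι) := Nat.cast_nonneg _
  have hu : ∑ p, Real.exp (θ * T p) * Real.exp (-θ * μ - θ * t) ≤
      Fintype.card (Equiv.Perm ι × Equiv.Perm ι) * R := by
    rw [← Finset.sum_mul]
    refine (mul_le_mul_of_nonneg_right hupper (Real.exp_pos _).le).trans ?_
    rw [mul_assoc, ← Real.exp_add]
    refine mul_le_mul_of_nonneg_left (Real.exp_le_exp.2 ?_) hcard
    linarith
  have hl : ∑ p, Real.exp (-θ * T p) * Real.exp (θ * μ - θ * t) ≤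
      Fintype.card (Equiv.Perm ι × Equiv.Perm ι) * R := by
    rw [← Finset.sum_mul]
    refine (mul_le_mul_of_nonneg_right hlower (Real.exp_pos _).le).trans ?_
    rw [mul_assoc, ← Real.exp_add]
    refine mul_le_mul_of_nonneg_left (Real.exp_le_exp.2 ?_) hcard
    have h : 2 * θ ^ 2 ≤ θ / (1 - 2 * θ) - θ := by
      rw [le_sub_iff_add_le, le_div_iff₀ hθ2]
      nlinarith [mul_nonneg hθ (mul_nonneg hθ hθ)]
    linarith [mul_le_mul_of_nonneg_left h hμ0]
  have hpoint (p : Equiv.Perm ι × Equiv.Perm ι) : (if t ≤ |T p - μ| then (1 : ℝ) else 0) ≤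
      Real.exp (θ * T p) * Real.exp (-θ * μ - θ * t) +
        Real.exp (-θ * T p) * Real.exp (θ * μ - θ * t) := by
    simp only [← Real.exp_add]
    split_ifs with h
    · rcases le_abs.1 h with h | h
      · refine (Real.one_le_exp ?_).trans (le_add_of_nonneg_right (Real.exp_pos _).le)
        linarith [mul_le_mul_of_nonneg_left h hθ]
      · refine (Real.one_le_exp ?_).trans (le_add_of_nonneg_left (Real.exp_pos _).le)
        linarith [mul_le_mul_of_nonneg_left h hθ]
    · positivity
  rw [← Finset.sum_boole]
  refine (Finset.sum_le_sum fun p _ => hpoint p).trans ?_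
  rw [Finset.sum_add_distrib]
  linarith

end Permutation

/-- Bernstein-type concentration for `T₂ = ∑ i, a i (σ i) (π i)` with `σ, π` independent
uniform permutations of `Fin n`, where `μ₂ = (∑ i, ∑ j, ∑ k, a i j k) / n² = E[T₂]`.
The `O(1/n)` terms of the paper are rendered as `K/n` for uniform constants `K > 0`,
`N ≥ 3`. -/
theorem T2_concentration :
    ∃ K : ℝ, 0 < K ∧ ∃ N : ℕ, 3 ≤ N ∧
      ∀ n : ℕ, N ≤ n →
        ∀ a : Fin n → Fin n → Fin n → ℝ, (∀ i j k, a i j k ∈ Set.Icc (0 : ℝ) 1) →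
          ∀ t : ℝ, 3 + K / n ≤ t →
            ((Finset.univ.filter
                fun p : Equiv.Perm (Fin n) × Equiv.Perm (Fin n) =>
                  t ≤ |(∑ i, a i (p.1 i) (p.2 i)) -
                        (∑ i, ∑ j, ∑ k, a i j k) / (n ^ 2 : ℝ)|).card : ℝ) /
              (Fintype.card (Equiv.Perm (Fin n) × Equiv.Perm (Fin n)) : ℝ) ≤
            2 * Real.exp (-(t - 3 - K / n) ^ 2 /
              (12 * ((∑ i, ∑ j, ∑ k, a i j k) / (n ^ 2 : ℝ)) + 18 +
                6 * (1 + K / n) * (t - 3))) := by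
  refine ⟨1, one_pos, 3, le_rfl, fun n hn a ha t ht => ?_⟩
  have hn0 : (0 : ℝ) < n := by exact_mod_cast (by omega : 0 < n)
  have : Nonempty (Fin n) := ⟨⟨0, by omega⟩⟩
  set μ := (∑ i, ∑ j, ∑ k, a i j k) / (n ^ 2 : ℝ) with hμdef
  have hμ0 : 0 ≤ μ := div_nonneg (Finset.sum_nonneg fun i _ => Finset.sum_nonneg fun j _ =>
    Finset.sum_nonneg fun k _ => (ha i j k).1) (by positivity)
  have hK : (0 : ℝ) < 1 / n := by positivity
  have ht0 : 0 < t := by linarith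
  have h := card_abs_sub_ge_le a ha μ (by rw [hμdef, Fintype.card_fin]; field_simp) hμ0 ht0
  rw [div_le_iff₀ (by exact_mod_cast Fintype.card_pos), mul_comm]
  convert h.trans ?_ using 1
  refine mul_le_mul_of_nonneg_left (mul_le_mul_of_nonneg_left (Real.exp_le_exp.2 ?_)
    zero_le_two) (Nat.cast_nonneg _)
  rw [neg_div, neg_div, neg_le_neg_iff]
  have hKt : 0 ≤ 1 / n * (t - 3) := mul_nonneg hK.le (by linarith)
  refine div_le_div₀ (by positivity) ?_ (by positivity) (by linarith)
  exact pow_le_pow_left₀ (by linarith) (by linarith) 2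
end

section
/- Let (Ω, ℱ, P) be a probability space, 𝒳 a measurable space, and X, X' : Ω → 𝒳 random variables such that (X, X') is an exchangeable pair, i.e. (X, X') and (X', X) have the same joint distribution. Let F : 𝒳 × 𝒳 → ℝ be a bounded measurable function that is antisymmetric, meaning F(x, y) = −F(y, x) for all x, y. Let f : 𝒳 → ℝ be a measurable function with f(X) = E[F(X, X') | X] almost surely, and define v(X) := (1/2)·E[|(f(X) − f(X'))·F(X, X')| | X]. Suppose there are constants B ≥ 0 and C > 0 such that v(X) ≤ C + B·f(X) almost surely. Then for every t > 0, P(|f(X)| ≥ t) ≤ 2·exp(−t² / (2C + 2Bt)). -/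
open MeasureTheory

/-- The trapezoidal upper bound for the integral of the exponential. -/
lemma Real.exp_sub_one_le_mul_div_two {d : ℝ} (hd : 0 ≤ d) :
    Real.exp d - 1 ≤ d * (Real.exp d + 1) / 2 := by
  have hder : ∀ x : ℝ, HasDerivAt (fun d : ℝ => d * (Real.exp d + 1) / 2 - Real.exp d)
      ((1 * (Real.exp x + 1) + x * Real.exp x) / 2 - Real.exp x) x := fun x =>
    (((hasDerivAt_id x).mul ((Real.hasDerivAt_exp x).add_const 1)).div_const 2).sub
      (Real.hasDerivAt_exp x)
  have hmono : Monotone (fun d : ℝ => d * (Real.exp d + 1) / 2 - Real.exp d) := by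
    refine monotone_of_deriv_nonneg (fun x => (hder x).differentiableAt) fun x => ?_
    rw [(hder x).deriv]
    have h1 : 1 - x ≤ Real.exp (-x) := by linarith [Real.add_one_le_exp (-x)]
    have h2 : Real.exp (-x) * Real.exp x = 1 := by rw [← Real.exp_add]; simp
    nlinarith [Real.exp_pos x]
  have h := hmono hd
  norm_num at h
  linarith

lemma Real.abs_exp_sub_exp_le (x y : ℝ) :
    |Real.exp x - Real.exp y| ≤ |x - y| * (Real.exp x + Real.exp y) / 2 := by
  wlog hxy : y ≤ x generalizing x y
  · rw [abs_sub_comm, abs_sub_comm x y, add_comm (Real.exp x)]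
    exact this y x (le_of_not_ge hxy)
  rw [abs_of_nonneg (sub_nonneg.2 (Real.exp_le_exp.2 hxy)), abs_of_nonneg (sub_nonneg.2 hxy)]
  have h := mul_le_mul_of_nonneg_left
    (Real.exp_sub_one_le_mul_div_two (sub_nonneg.2 hxy)) (Real.exp_pos y).le
  have he : Real.exp y * Real.exp (x - y) = Real.exp x := by rw [← Real.exp_add]; ring_nf
  calc _ = Real.exp y * (Real.exp (x - y) - 1) := by rw [mul_sub, he, mul_one]
    _ ≤ _ := h
    _ = (x - y) * (Real.exp y * Real.exp (x - y) + Real.exp y) / 2 := by ring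
    _ = _ := by rw [he]

section

variable {Ω : Type*} {m : MeasurableSpace Ω} [mΩ : MeasurableSpace Ω]
  {μ : Measure Ω}

lemma norm_exp_mul_le_of_abs_le {Y : Ω → ℝ} {R : ℝ} (hbd : ∀ᵐ ω ∂μ, |Y ω| ≤ R) (θ : ℝ) :
    ∀ᵐ ω ∂μ, ‖Real.exp (θ * Y ω)‖ ≤ Real.exp (|θ| * R) := by
  filter_upwards [hbd] with ω hω
  rw [Real.norm_eq_abs, Real.abs_exp, Real.exp_le_exp]
  calc θ * Y ω ≤ |θ * Y ω| := le_abs_self _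
    _ = |θ| * |Y ω| := abs_mul _ _
    _ ≤ |θ| * R := by gcongr

lemma integrable_mul_exp_of_abs_le {Y G : Ω → ℝ} {R : ℝ} (hY : Measurable Y)
    (hbd : ∀ᵐ ω ∂μ, |Y ω| ≤ R) (hG : Integrable G μ) (θ : ℝ) :
    Integrable (fun ω => G ω * Real.exp (θ * Y ω)) μ :=
  hG.mul_bdd (by fun_prop) (norm_exp_mul_le_of_abs_le hbd θ)

lemma integral_condExp_mul [IsProbabilityMeasure μ] {G H : Ω → ℝ} (hm : m ≤ mΩ) (hH : StronglyMeasurable[m] H)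
    (hG : Integrable G μ) (hGH : Integrable (fun ω => G ω * H ω) μ) :
    ∫ ω, (μ[G | m]) ω * H ω ∂μ = ∫ ω, G ω * H ω ∂μ := by
  rw [← integral_condExp hm (f := fun ω => G ω * H ω)]
  exact integral_congr_ae (condExp_mul_of_stronglyMeasurable_right hH hGH hG).symm

/-- Chernoff bound from a differential inequality on the moment generating function. -/
lemma measureReal_ge_le_exp_of_deriv_mgf_le [IsProbabilityMeasure μ] {Y : Ω → ℝ} {R K t : ℝ} (hY : Measurable Y)
    (hbd : ∀ᵐ ω ∂μ, |Y ω| ≤ R) (hK : 0 < K) (ht : 0 < t)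
    (hder : ∀ θ, 0 < θ → θ < t / K →
      ∫ ω, Y ω * Real.exp (θ * Y ω) ∂μ ≤ K * θ * ProbabilityTheory.mgf Y μ θ) :
    μ.real {ω | t ≤ Y ω} ≤ Real.exp (-t ^ 2 / (2 * K)) := by
  have hint : ∀ θ : ℝ, Integrable (fun ω => Real.exp (θ * Y ω)) μ := fun θ =>
    .of_bound (by fun_prop) _ (norm_exp_mul_le_of_abs_le hbd θ)
  have huniv : ProbabilityTheory.integrableExpSet Y μ = Set.univ :=
    Set.eq_univ_of_forall hint
  have hs : 0 < t / K := by positivity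
  have hd : ∀ θ, HasDerivAt
      (fun θ => ProbabilityTheory.mgf Y μ θ * Real.exp (-(K * θ ^ 2 / 2)))
      ((∫ ω, Y ω * Real.exp (θ * Y ω) ∂μ) * Real.exp (-(K * θ ^ 2 / 2)) +
        ProbabilityTheory.mgf Y μ θ * (Real.exp (-(K * θ ^ 2 / 2)) * (-(K * θ)))) θ := by
    intro θ
    refine (ProbabilityTheory.hasDerivAt_mgf (by simp [huniv])).mul ?_
    refine HasDerivAt.exp ?_
    convert! ((((hasDerivAt_id θ).pow 2).const_mul K).div_const 2).neg using 1
    simp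
    ring
  have hanti : AntitoneOn (fun θ => ProbabilityTheory.mgf Y μ θ * Real.exp (-(K * θ ^ 2 / 2)))
      (Set.Icc 0 (t / K)) := by
    refine antitoneOn_of_deriv_nonpos (convex_Icc _ _)
      (fun θ _ => (hd θ).continuousAt.continuousWithinAt)
      (fun θ _ => (hd θ).differentiableAt.differentiableWithinAt) fun θ hθ => ?_
    rw [interior_Icc] at hθ
    rw [(hd θ).deriv]
    have := mul_le_mul_of_nonneg_right (hder θ hθ.1 hθ.2) (Real.exp_pos (-(K * θ ^ 2 / 2))).le
    linarith
  have h := hanti (Set.left_mem_Icc.2 hs.le) (Set.right_mem_Icc.2 hs.le) hs.le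
  simp only [ProbabilityTheory.mgf_zero, ne_eq, OfNat.ofNat_ne_zero, not_false_eq_true, zero_pow,
    mul_zero, zero_div, neg_zero, Real.exp_zero, mul_one, Real.exp_neg] at h
  rw [← div_eq_mul_inv, div_le_one (Real.exp_pos _)] at h
  calc μ.real {ω | t ≤ Y ω} ≤ Real.exp (-(t / K) * t) * ProbabilityTheory.mgf Y μ (t / K) :=
        ProbabilityTheory.measure_ge_le_exp_mul_mgf t hs.le (hint _)
    _ ≤ Real.exp (-(t / K) * t) * Real.exp (K * (t / K) ^ 2 / 2) := by gcongr
    _ = Real.exp (-t ^ 2 / (2 * K)) := by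
        rw [← Real.exp_add]
        congr 1
        field_simp
        ring

end

/-- The derivative bound for the moment generating function of `f(X)`. -/
lemma abs_integral_mul_exp_le_of_exchangeable
    {Ω 𝒳 : Type*} [MeasurableSpace Ω] [MeasurableSpace 𝒳]
    {μ : Measure Ω} [IsProbabilityMeasure μ]
    {X X' : Ω → 𝒳} (hX : Measurable X) (hX' : Measurable X')
    (hexch : μ.map (fun ω => (X ω, X' ω)) = μ.map (fun ω => (X' ω, X ω)))
    {F : 𝒳 × 𝒳 → ℝ} (hF : Measurable F) {M : ℝ} (hFbdd : ∀ p, |F p| ≤ M)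
    (hFanti : ∀ x y, F (x, y) = -F (y, x))
    {f : 𝒳 → ℝ} (hf : Measurable f) {R : ℝ} (hbd : ∀ᵐ ω ∂μ, |f (X ω)| ≤ R)
    (hfX : (fun ω => f (X ω)) =ᵐ[μ]
      μ[fun ω => F (X ω, X' ω) | MeasurableSpace.comap X ‹MeasurableSpace 𝒳›])
    {B C : ℝ}
    (hv : ∀ᵐ ω ∂μ,
      (μ[fun ω => |(f (X ω) - f (X' ω)) * F (X ω, X' ω)| |
          MeasurableSpace.comap X ‹MeasurableSpace 𝒳›]) ω / 2 ≤ C + B * f (X ω))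
    (θ : ℝ) :
    |∫ ω, f (X ω) * Real.exp (θ * f (X ω)) ∂μ| ≤
      |θ| * (C * ProbabilityTheory.mgf (fun ω => f (X ω)) μ θ +
        B * ∫ ω, f (X ω) * Real.exp (θ * f (X ω)) ∂μ) := by
  have hswap : ∀ G : 𝒳 × 𝒳 → ℝ, Measurable G →
      ∫ ω, G (X ω, X' ω) ∂μ = ∫ ω, G (X' ω, X ω) ∂μ := by
    intro G hG
    rw [← integral_map (φ := fun ω => (X ω, X' ω)) (by fun_prop) hG.aestronglyMeasurable, hexch,
      integral_map (by fun_prop) hG.aestronglyMeasurable]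
  have hbd' : ∀ᵐ ω ∂μ, |f (X' ω)| ≤ R := by
    have hS : MeasurableSet {p : 𝒳 × 𝒳 | |f p.1| ≤ R} :=
      measurableSet_le (by fun_prop) measurable_const
    have h : ∀ᵐ p ∂(μ.map fun ω => (X ω, X' ω)), |f p.1| ≤ R :=
      (ae_map_iff (by fun_prop) hS).2 hbd
    rw [hexch] at h
    exact (ae_map_iff (by fun_prop) hS).1 h
  have hYint : Integrable (fun ω => f (X ω)) μ := .of_bound (Measurable.aestronglyMeasurable (by fun_prop)) R hbd
  have hYint' : Integrable (fun ω => f (X' ω)) μ := .of_bound (Measurable.aestronglyMeasurable (by fun_prop)) R hbd'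
  have hDint : Integrable (fun ω => F (X ω, X' ω)) μ :=
    .of_bound (Measurable.aestronglyMeasurable (by fun_prop)) M (ae_of_all _ fun _ => hFbdd _)
  have hWint : Integrable (fun ω => |(f (X ω) - f (X' ω)) * F (X ω, X' ω)|) μ :=
    ((hYint.sub hYint').mul_bdd (Measurable.aestronglyMeasurable (by fun_prop))
      (ae_of_all _ fun _ => hFbdd _)).abs
  have hexpint : Integrable (fun ω => Real.exp (θ * f (X ω))) μ :=
    .of_bound (Measurable.aestronglyMeasurable (by fun_prop)) _ (norm_exp_mul_le_of_abs_le hbd θ)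
  have hDe := integrable_mul_exp_of_abs_le (by fun_prop) hbd hDint θ
  have hDe' := integrable_mul_exp_of_abs_le (by fun_prop) hbd' hDint θ
  have hWe := integrable_mul_exp_of_abs_le (by fun_prop) hbd hWint θ
  have hWe' := integrable_mul_exp_of_abs_le (by fun_prop) hbd' hWint θ
  have hYe := integrable_mul_exp_of_abs_le (by fun_prop) hbd hYint θ
  have hsm : StronglyMeasurable[MeasurableSpace.comap X ‹MeasurableSpace 𝒳›]
      (fun ω => Real.exp (θ * f (X ω))) := by
    have hg : Measurable fun x => Real.exp (θ * f x) := by fun_prop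
    exact (hg.comp (comap_measurable X)).stronglyMeasurable
  have h1 : ∫ ω, f (X ω) * Real.exp (θ * f (X ω)) ∂μ =
      ∫ ω, F (X ω, X' ω) * Real.exp (θ * f (X ω)) ∂μ := by
    rw [← integral_condExp_mul hX.comap_le hsm hDint hDe]
    refine integral_congr_ae ?_
    filter_upwards [hfX] with ω hω
    rw [← hω]
  have h2 : ∫ ω, F (X ω, X' ω) * Real.exp (θ * f (X ω)) ∂μ =
      -∫ ω, F (X ω, X' ω) * Real.exp (θ * f (X' ω)) ∂μ := by
    rw [hswap (fun p => F p * Real.exp (θ * f p.1)) (by fun_prop), ← integral_neg]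
    refine integral_congr_ae (ae_of_all _ fun ω => ?_)
    simp only [hFanti (X' ω) (X ω), neg_mul]
  have h3 : 2 * ∫ ω, f (X ω) * Real.exp (θ * f (X ω)) ∂μ =
      ∫ ω, (F (X ω, X' ω) * Real.exp (θ * f (X ω)) -
        F (X ω, X' ω) * Real.exp (θ * f (X' ω))) ∂μ := by
    rw [integral_sub hDe hDe']
    linarith
  have h4 : ∫ ω, |(f (X ω) - f (X' ω)) * F (X ω, X' ω)| * Real.exp (θ * f (X' ω)) ∂μ =
      ∫ ω, |(f (X ω) - f (X' ω)) * F (X ω, X' ω)| * Real.exp (θ * f (X ω)) ∂μ := by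
    rw [hswap (fun p => |(f p.1 - f p.2) * F p| * Real.exp (θ * f p.2)) (by fun_prop)]
    refine integral_congr_ae (ae_of_all _ fun ω => ?_)
    simp only [hFanti (X' ω) (X ω), abs_mul, abs_neg, abs_sub_comm (f (X' ω))]
  have h5 : |2 * ∫ ω, f (X ω) * Real.exp (θ * f (X ω)) ∂μ| ≤
      ∫ ω, |θ| / 2 * (|(f (X ω) - f (X' ω)) * F (X ω, X' ω)| * Real.exp (θ * f (X ω)) +
        |(f (X ω) - f (X' ω)) * F (X ω, X' ω)| * Real.exp (θ * f (X' ω))) ∂μ := by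
    rw [h3, ← Real.norm_eq_abs]
    refine norm_integral_le_of_norm_le ((hWe.add hWe').const_mul _) (ae_of_all _ fun ω => ?_)
    rw [Real.norm_eq_abs, ← mul_sub, abs_mul]
    calc _ ≤ |F (X ω, X' ω)| * (|θ * f (X ω) - θ * f (X' ω)| *
          (Real.exp (θ * f (X ω)) + Real.exp (θ * f (X' ω))) / 2) := by
          gcongr
          exact Real.abs_exp_sub_exp_le _ _
      _ = _ := by
          rw [← mul_sub, abs_mul, abs_mul]
          ring
  rw [integral_const_mul, integral_add hWe hWe', h4,
    ← integral_condExp_mul hX.comap_le hsm hWint hWe, abs_mul, abs_two] at h5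
  have h6 : ∫ ω, (μ[fun ω => |(f (X ω) - f (X' ω)) * F (X ω, X' ω)| |
          MeasurableSpace.comap X ‹MeasurableSpace 𝒳›]) ω * Real.exp (θ * f (X ω)) ∂μ ≤
      ∫ ω, 2 * (C * Real.exp (θ * f (X ω)) + B * (f (X ω) * Real.exp (θ * f (X ω)))) ∂μ := by
    refine integral_mono_ae
      (integrable_mul_exp_of_abs_le (by fun_prop) hbd integrable_condExp θ)
      (((hexpint.const_mul C).add (hYe.const_mul B)).const_mul 2) ?_
    filter_upwards [hv] with ω hω
    have := mul_le_mul_of_nonneg_right hω (Real.exp_pos (θ * f (X ω))).le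
    linarith
  rw [integral_const_mul, integral_add (hexpint.const_mul C) (hYe.const_mul B),
    integral_const_mul, integral_const_mul] at h6
  have h7 := mul_le_mul_of_nonneg_left h6 (abs_nonneg θ)
  rw [ProbabilityTheory.mgf]
  linarith

/-- Chatterjee's exchangeable-pair concentration inequality (Theorem 3.9 in
Chatterjee's thesis): if `(X, X')` is an exchangeable pair, `F` is a bounded
measurable antisymmetric function, `f(X) = E[F(X,X') | X]` a.s., and
`v(X) := (1/2)·E[|(f(X) - f(X'))·F(X,X')| | X] ≤ C + B·f(X)` a.s., then
`P(|f(X)| ≥ t) ≤ 2·exp(-t²/(2C + 2Bt))`. -/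
theorem exchangeable_pair_concentration
    {Ω 𝒳 : Type*} [MeasurableSpace Ω] [MeasurableSpace 𝒳]
    (μ : Measure Ω) [IsProbabilityMeasure μ]
    (X X' : Ω → 𝒳) (hX : Measurable X) (hX' : Measurable X')
    (hexch : μ.map (fun ω => (X ω, X' ω)) = μ.map (fun ω => (X' ω, X ω)))
    (F : 𝒳 × 𝒳 → ℝ) (hF : Measurable F) (M : ℝ) (hFbdd : ∀ p, |F p| ≤ M)
    (hFanti : ∀ x y, F (x, y) = -F (y, x))
    (f : 𝒳 → ℝ) (hf : Measurable f)
    (hfX : (fun ω => f (X ω)) =ᵐ[μ]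
      μ[fun ω => F (X ω, X' ω) | MeasurableSpace.comap X ‹MeasurableSpace 𝒳›])
    (B C : ℝ) (hB : 0 ≤ B) (hC : 0 < C)
    (hv : ∀ᵐ ω ∂μ,
      (μ[fun ω => |(f (X ω) - f (X' ω)) * F (X ω, X' ω)| |
          MeasurableSpace.comap X ‹MeasurableSpace 𝒳›]) ω / 2 ≤ C + B * f (X ω))
    (t : ℝ) (ht : 0 < t) :
    μ {ω | t ≤ |f (X ω)|} ≤
      ENNReal.ofReal (2 * Real.exp (-t ^ 2 / (2 * C + 2 * B * t))) := by
  have hY : Measurable fun ω => f (X ω) := by fun_prop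
  have hbd : ∀ᵐ ω ∂μ, |f (X ω)| ≤ M := by
    have h := ae_bdd_abs_condExp_of_ae_bdd_abs (μ := μ) (R := M)
      (m := MeasurableSpace.comap X ‹MeasurableSpace 𝒳›)
      (f := fun ω => F (X ω, X' ω)) (ae_of_all _ fun _ => hFbdd _)
    filter_upwards [h, hfX] with ω hω hω'
    rw [hω']
    exact hω
  have key := abs_integral_mul_exp_le_of_exchangeable hX hX' hexch hF hFbdd hFanti hf hbd hfX hv
  have hK : 0 < C + B * t := by positivity
  have hupper : μ.real {ω | t ≤ f (X ω)} ≤ Real.exp (-t ^ 2 / (2 * (C + B * t))) := by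
    refine measureReal_ge_le_exp_of_deriv_mgf_le hY hbd hK ht fun θ hθ hθt => ?_
    have h := (le_abs_self _).trans (key θ)
    have hm : 0 ≤ ProbabilityTheory.mgf (fun ω => f (X ω)) μ θ := ProbabilityTheory.mgf_nonneg
    rw [abs_of_pos hθ] at h
    rw [lt_div_iff₀ hK] at hθt
    generalize ∫ ω, f (X ω) * Real.exp (θ * f (X ω)) ∂μ = I at h ⊢
    rcases le_or_gt I 0 with hI | hI
    · exact hI.trans (by positivity)
    · refine le_of_mul_le_mul_left ?_ hC
      have h1 := mul_le_mul_of_nonneg_left h hK.le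
      have h2 := mul_le_mul_of_nonneg_left hθt.le (mul_nonneg hB hI.le)
      linarith
  have hlower : μ.real {ω | t ≤ -f (X ω)} ≤ Real.exp (-t ^ 2 / (2 * (C + B * t))) := by
    refine measureReal_ge_le_exp_of_deriv_mgf_le hY.neg (by simpa using hbd) hK ht
      fun θ hθ _ => ?_
    have h := (neg_le_abs _).trans (key (-θ))
    have hmgf : ProbabilityTheory.mgf (fun ω => -f (X ω)) μ θ =
        ProbabilityTheory.mgf (fun ω => f (X ω)) μ (-θ) := ProbabilityTheory.mgf_neg
    have hm : 0 ≤ ProbabilityTheory.mgf (fun ω => f (X ω)) μ (-θ) := ProbabilityTheory.mgf_nonneg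
    have hI : ∫ ω, -f (X ω) * Real.exp (θ * -f (X ω)) ∂μ =
        -∫ ω, f (X ω) * Real.exp (-θ * f (X ω)) ∂μ := by
      simp only [← integral_neg, neg_mul, mul_neg]
    rw [hI]
    change _ ≤ _ * ProbabilityTheory.mgf (fun ω => -f (X ω)) μ θ
    rw [hmgf]
    rw [abs_neg, abs_of_pos hθ] at h
    generalize ∫ ω, f (X ω) * Real.exp (-θ * f (X ω)) ∂μ = I at h ⊢
    generalize ProbabilityTheory.mgf (fun ω => f (X ω)) μ (-θ) = m at h hm ⊢
    rcases le_or_gt 0 I with hI | hI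
    · exact (neg_nonpos.2 hI).trans (by positivity)
    · have h1 : 0 ≤ θ * (B * -I) := by
        have := neg_pos.2 hI
        positivity
      have h2 : 0 ≤ B * t * θ * m := by positivity
      linarith
  rw [← ofReal_measureReal]
  refine ENNReal.ofReal_le_ofReal ?_
  have hsub : {ω | t ≤ |f (X ω)|} ⊆ {ω | t ≤ f (X ω)} ∪ {ω | t ≤ -f (X ω)} :=
    fun ω (hω : t ≤ |f (X ω)|) => le_abs.1 hω
  have hK2 : 2 * C + 2 * B * t = 2 * (C + B * t) := by ring
  rw [hK2]
  calc μ.real {ω | t ≤ |f (X ω)|} ≤ μ.real ({ω | t ≤ f (X ω)} ∪ {ω | t ≤ -f (X ω)}) :=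
        measureReal_mono hsub
    _ ≤ _ := measureReal_union_le _ _
    _ ≤ _ := by linarith
end

section
/- Let σ, π be independent uniformly random permutations of [n], let (I1, I2, I3) be drawn uniformly at random from the set of ordered triples of pairwise distinct elements of [n], and let b be uniform on {1, 2}, with σ, π, (I1,I2,I3), b all independent. Define (σ', π') = (σ ∘ τ1(I1,I2,I3), π ∘ τ2(I1,I2,I3)) if b = 1 and (σ', π') = (σ ∘ τ2(I1,I2,I3), π ∘ τ1(I1,I2,I3)) if b = 2, and set T2 = Σ_{i=1}^n a_{i,σ(i),π(i)} and T2' = Σ_{i=1}^n a_{i,σ'(i),π'(i)}. Then (T2, T2') is an exchangeable pair: the random vector (T2, T2') has the same distribution as (T2', T2). -/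
open scoped Classical

/-- The 3-cycle sending `i1 ↦ i2, i2 ↦ i3, i3 ↦ i1` (for pairwise distinct
`i1, i2, i3`), fixing all other elements. -/
def tau1 {n : ℕ} (i1 i2 i3 : Fin n) : Equiv.Perm (Fin n) :=
  Equiv.swap i1 i3 * Equiv.swap i1 i2

/-- The inverse 3-cycle, sending `i1 ↦ i3, i3 ↦ i2, i2 ↦ i1`. -/
def tau2 {n : ℕ} (i1 i2 i3 : Fin n) : Equiv.Perm (Fin n) :=
  (tau1 i1 i2 i3)⁻¹

/-- `T₂(σ, π) = ∑ i, a i (σ i) (π i)`. -/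
def T2stat {n : ℕ} (a : Fin n → Fin n → Fin n → ℝ) (σ π : Equiv.Perm (Fin n)) : ℝ :=
  ∑ i, a i (σ i) (π i)

/-- `T₂' = ∑ i, a i (σ' i) (π' i)` where `(σ', π') = (σ ∘ τ₁, π ∘ τ₂)` if `b` (i.e. `b = 1`),
and `(σ', π') = (σ ∘ τ₂, π ∘ τ₁)` otherwise (i.e. `b = 2`). -/
def T2stat' {n : ℕ} (a : Fin n → Fin n → Fin n → ℝ) (σ π : Equiv.Perm (Fin n))
    (p : Fin n × Fin n × Fin n) (b : Bool) : ℝ :=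
  if b then ∑ i, a i (σ (tau1 p.1 p.2.1 p.2.2 i)) (π (tau2 p.1 p.2.1 p.2.2 i))
  else ∑ i, a i (σ (tau2 p.1 p.2.1 p.2.2 i)) (π (tau1 p.1 p.2.1 p.2.2 i))

/-- The resampling move `(σ, π, p, b) ↦ (σ', π', p, ¬b)` on the sample space, replacing the
permutations by their perturbed versions and flipping the coin. -/
def exchangeMove {n : ℕ} (w : Equiv.Perm (Fin n) × Equiv.Perm (Fin n) ×
    (Fin n × Fin n × Fin n) × Bool) :
    Equiv.Perm (Fin n) × Equiv.Perm (Fin n) × (Fin n × Fin n × Fin n) × Bool :=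
  let t := tau1 w.2.2.1.1 w.2.2.1.2.1 w.2.2.1.2.2
  if w.2.2.2 then (w.1 * t, w.2.1 * t⁻¹, w.2.2.1, false)
  else (w.1 * t⁻¹, w.2.1 * t, w.2.2.1, true)

theorem exchangeMove_involutive {n : ℕ} :
    Function.Involutive (exchangeMove (n := n)) := by
  rintro ⟨σ, π, p, b⟩
  cases b <;> simp [exchangeMove]

theorem exchangeMove_triple {n : ℕ} (w : Equiv.Perm (Fin n) × Equiv.Perm (Fin n) ×
    (Fin n × Fin n × Fin n) × Bool) : (exchangeMove w).2.2.1 = w.2.2.1 := by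
  obtain ⟨σ, π, p, b⟩ := w
  cases b <;> simp [exchangeMove]

theorem T2stat_exchangeMove {n : ℕ} (a : Fin n → Fin n → Fin n → ℝ)
    (w : Equiv.Perm (Fin n) × Equiv.Perm (Fin n) × (Fin n × Fin n × Fin n) × Bool) :
    T2stat a (exchangeMove w).1 (exchangeMove w).2.1 =
      T2stat' a w.1 w.2.1 w.2.2.1 w.2.2.2 := by
  obtain ⟨σ, π, p, b⟩ := w
  cases b <;> simp [exchangeMove, T2stat, T2stat', tau2]

theorem T2stat'_exchangeMove {n : ℕ} (a : Fin n → Fin n → Fin n → ℝ)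
    (w : Equiv.Perm (Fin n) × Equiv.Perm (Fin n) × (Fin n × Fin n × Fin n) × Bool) :
    T2stat' a (exchangeMove w).1 (exchangeMove w).2.1 (exchangeMove w).2.2.1
      (exchangeMove w).2.2.2 = T2stat a w.1 w.2.1 := by
  rw [← T2stat_exchangeMove, exchangeMove_involutive]

/-- `(T₂, T₂')` is an exchangeable pair, where `σ, π` are independent uniform permutations,
`(I₁, I₂, I₃)` is uniform on ordered triples of pairwise distinct elements of `Fin n`, and
`b` is a fair coin, all independent.  On this finite uniform sample space, equality in
distribution of `(T₂, T₂')` and `(T₂', T₂)` is exactly the statement that for every pair of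
values `(x, x')` the two events have the same number of outcomes. -/
theorem T2_exchangeable_pair
    (n : ℕ) (hn : 3 ≤ n) (a : Fin n → Fin n → Fin n → ℝ)
    (ha : ∀ i j k, a i j k ∈ Set.Icc (0 : ℝ) 1) (x x' : ℝ) :
    (Finset.univ.filter fun w : Equiv.Perm (Fin n) × Equiv.Perm (Fin n) ×
        (Fin n × Fin n × Fin n) × Bool =>
        (w.2.2.1.1 ≠ w.2.2.1.2.1 ∧ w.2.2.1.1 ≠ w.2.2.1.2.2 ∧ w.2.2.1.2.1 ≠ w.2.2.1.2.2) ∧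
        T2stat a w.1 w.2.1 = x ∧ T2stat' a w.1 w.2.1 w.2.2.1 w.2.2.2 = x').card =
    (Finset.univ.filter fun w : Equiv.Perm (Fin n) × Equiv.Perm (Fin n) ×
        (Fin n × Fin n × Fin n) × Bool =>
        (w.2.2.1.1 ≠ w.2.2.1.2.1 ∧ w.2.2.1.1 ≠ w.2.2.1.2.2 ∧ w.2.2.1.2.1 ≠ w.2.2.1.2.2) ∧
        T2stat a w.1 w.2.1 = x' ∧ T2stat' a w.1 w.2.1 w.2.2.1 w.2.2.2 = x).card := by
  refine Finset.card_equiv (exchangeMove_involutive (n := n)).toPerm fun w => ?_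
  simp only [Finset.mem_filter, Finset.mem_univ, true_and, Function.Involutive.coe_toPerm,
    exchangeMove_triple, T2stat_exchangeMove]
  have h := T2stat'_exchangeMove a w
  rw [exchangeMove_triple] at h
  rw [h]
  tauto
end

section
/- For every permutation σ of [n], (1/n²)·Σ_{i=1}^n Σ_{k=1}^n Σ_{j=1}^n (a_{i,j,σ(i)} + a_{k,j,σ(k)} − a_{i,j,σ(k)} − a_{k,j,σ(i)}) = (2/n)·(T1(σ) − μ1). Equivalently, if I1, I2 are independent uniform on [n] and T1' = Σ_{i,j} a_{i,j,σ∘(I1,I2)(i)}, then the conditional expectation of T1 − T1' given σ equals (2/n)·(T1(σ) − μ1). -/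
/-- Exchange identity for a function on a square: summing `f i (σ i) + f k (σ k) - f i (σ k) - f k (σ i)`
over all pairs gives twice the excess of the `σ`-diagonal, scaled by the size, over the full sum. -/
theorem sum_sum_exchange_perm {ι R : Type*} [Fintype ι] [CommRing R] (f : ι → ι → R)
    (σ : Equiv.Perm ι) :
    ∑ i, ∑ k, (f i (σ i) + f k (σ k) - f i (σ k) - f k (σ i)) =
      2 * (Fintype.card ι * ∑ i, f i (σ i) - ∑ i, ∑ k, f i k) := by
  have h (i : ι) : ∑ k, f i (σ k) = ∑ k, f i k := Equiv.sum_comp σ (f i)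
  have h' : ∑ i, ∑ k, f k (σ i) = ∑ i, ∑ k, f i k := by
    rw [Finset.sum_comm]
    exact Finset.sum_congr rfl fun i _ => h i
  simp only [Finset.sum_sub_distrib, Finset.sum_add_distrib, h, h', Finset.sum_const,
    Finset.card_univ, nsmul_eq_mul, ← Finset.mul_sum]
  ring

/-- `E[T₁ - T₁' | σ] = (2/n)·(T₁(σ) - μ₁)`: for every permutation `σ`,
`(1/n²)·∑_{i,k,j} (a i j (σ i) + a k j (σ k) - a i j (σ k) - a k j (σ i))
  = (2/n)·(T₁(σ) - μ₁)`, where `T₁(σ) = ∑ i, ∑ j, a i j (σ i)` and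
`μ₁ = (∑ i, ∑ j, ∑ k, a i j k)/n`. -/
theorem T1_conditional_expectation_identity
    (n : ℕ) (hn : 0 < n) (a : Fin n → Fin n → Fin n → ℝ)
    (ha : ∀ i j k, a i j k ∈ Set.Icc (0 : ℝ) 1) (σ : Equiv.Perm (Fin n)) :
    (1 / (n : ℝ) ^ 2) *
        ∑ i, ∑ k, ∑ j, (a i j (σ i) + a k j (σ k) - a i j (σ k) - a k j (σ i)) =
      (2 / (n : ℝ)) *
        ((∑ i, ∑ j, a i j (σ i)) - (∑ i, ∑ j, ∑ k, a i j k) / n) := by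
  have hn' : (n : ℝ) ≠ 0 := Nat.cast_ne_zero.mpr hn.ne'
  have key := sum_sum_exchange_perm (fun i k => ∑ j, a i j k) σ
  simp only [← Finset.sum_add_distrib, ← Finset.sum_sub_distrib, Fintype.card_fin] at key
  have hswap : ∑ i, ∑ k, ∑ j, a i j k = ∑ i, ∑ j, ∑ k, a i j k :=
    Finset.sum_congr rfl fun _ _ => Finset.sum_comm
  rw [key, hswap]
  field_simp
end

section
/- For every permutation σ of [n], (n/4)·(1/n²)·Σ_{i=1}^n Σ_{k=1}^n ( Σ_{j=1}^n (a_{i,j,σ(i)} + a_{k,j,σ(k)} − a_{i,j,σ(k)} − a_{k,j,σ(i)}) )² ≤ n·(T1(σ) + μ1). In the language of exchangeable pairs, the quantity v(T1) = (n/4)·E[(T1 − T1')² | σ] satisfies v(T1) ≤ n·(T1(σ) − μ1) + 2n·μ1. -/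
/-- A signed sum of four numbers in `[0, c]`, two with each sign, has square at most `2c` times
the unsigned sum. -/
lemma sq_add_sub_sub_le {c p q r s : ℝ} (hp : p ∈ Set.Icc 0 c) (hq : q ∈ Set.Icc 0 c)
    (hr : r ∈ Set.Icc 0 c) (hs : s ∈ Set.Icc 0 c) :
    (p + q - r - s) ^ 2 ≤ 2 * c * (p + q + r + s) := by
  obtain ⟨hp0, hpc⟩ := hp
  obtain ⟨hq0, hqc⟩ := hq
  obtain ⟨hr0, hrc⟩ := hr
  obtain ⟨hs0, hsc⟩ := hs
  have habs : |p + q - r - s| ≤ 2 * c := abs_le.2 ⟨by linarith, by linarith⟩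
  have habs' : |p + q - r - s| ≤ p + q + r + s := abs_le.2 ⟨by linarith, by linarith⟩
  rw [← sq_abs, sq]
  exact mul_le_mul habs habs' (abs_nonneg _) (by linarith)

/-- Summing the squared increments of `∑ i, b i (σ i)` under all transpositions. -/
lemma sum_sq_transposition_increment_le {ι : Type*} [Fintype ι] {c : ℝ} {b : ι → ι → ℝ}
    (hb : ∀ i k, b i k ∈ Set.Icc 0 c) (σ : Equiv.Perm ι) :
    ∑ i, ∑ k, (b i (σ i) + b k (σ k) - b i (σ k) - b k (σ i)) ^ 2 ≤
      4 * c * (Fintype.card ι * ∑ i, b i (σ i) + ∑ i, ∑ k, b i k) := by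
  have hrow : ∑ i, ∑ k, b i (σ k) = ∑ i, ∑ k, b i k :=
    Finset.sum_congr rfl fun i _ => Equiv.sum_comp σ (b i)
  have hcol : ∑ i, ∑ k, b k (σ i) = ∑ i, ∑ k, b i k := by
    rw [Finset.sum_comm, hrow]
  calc
    _ ≤ ∑ i, ∑ k, 2 * c * (b i (σ i) + b k (σ k) + b i (σ k) + b k (σ i)) :=
      Finset.sum_le_sum fun i _ => Finset.sum_le_sum fun k _ =>
        sq_add_sub_sub_le (hb _ _) (hb _ _) (hb _ _) (hb _ _)
    _ = _ := by
      simp only [← Finset.mul_sum, Finset.sum_add_distrib, hrow, hcol, Finset.sum_const,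
        Finset.card_univ, nsmul_eq_mul]
      ring


/-- The stochastic bound `v(T₁) = (n/4)·E[(T₁ - T₁')² | σ]` satisfies
`v(T₁) ≤ n·(T₁(σ) + μ₁) = n·(T₁(σ) - μ₁) + 2n·μ₁`: for every permutation `σ`,
`(n/4)·(1/n²)·∑_{i,k} (∑_j (a i j (σ i) + a k j (σ k) - a i j (σ k) - a k j (σ i)))²
  ≤ n·(T₁(σ) + μ₁)`, where `T₁(σ) = ∑ i, ∑ j, a i j (σ i)` and
`μ₁ = (∑ i, ∑ j, ∑ k, a i j k)/n`. -/
theorem T1_variance_bound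
    (n : ℕ) (hn : 0 < n) (a : Fin n → Fin n → Fin n → ℝ)
    (ha : ∀ i j k, a i j k ∈ Set.Icc (0 : ℝ) 1) (σ : Equiv.Perm (Fin n)) :
    ((n : ℝ) / 4) * (1 / (n : ℝ) ^ 2) *
        ∑ i, ∑ k,
          (∑ j, (a i j (σ i) + a k j (σ k) - a i j (σ k) - a k j (σ i))) ^ 2 ≤
      (n : ℝ) * ((∑ i, ∑ j, a i j (σ i)) + (∑ i, ∑ j, ∑ k, a i j k) / n) := by
  have hb : ∀ i k, ∑ j, a i j k ∈ Set.Icc (0 : ℝ) n := fun i k =>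
    ⟨Finset.sum_nonneg fun j _ => (ha i j k).1,
      (Finset.sum_le_sum fun j _ => (ha i j k).2).trans_eq (by simp)⟩
  have hswap : ∑ i, ∑ j, ∑ k, a i j k = ∑ i, ∑ k, ∑ j, a i j k :=
    Finset.sum_congr rfl fun i _ => Finset.sum_comm
  have hn' : (0 : ℝ) < n := Nat.cast_pos.2 hn
  have key := sum_sq_transposition_increment_le hb σ
  rw [Fintype.card_fin] at key
  simp only [Finset.sum_sub_distrib, Finset.sum_add_distrib, hswap]
  refine (mul_le_mul_of_nonneg_left key (by positivity)).trans_eq ?_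
  field_simp
end

section
/- For all permutations σ, π of [n], the average of T2(σ,π) − T2'(σ,π,i1,i2,i3,b) — taken over all ordered triples (i1,i2,i3) ∈ [n]³ of pairwise distinct elements (each with weight 1/(n(n−1)(n−2))) and over b ∈ {1,2} (each with weight 1/2) — equals (3(n² − 3n + 3)/(n(n−1)(n−2)))·(T2(σ,π) − μ2) − 9μ2/(n(n−2)) + 3·Y(σ,π)/(n(n−1)(n−2)). -/
/-- `Y(σ,π)`: the sum of `a i (σ j) (π k)` over all ordered triples `(i,j,k)` having
exactly two distinct values among `i, j, k`. -/
def Ystat {n : ℕ} (a : Fin n → Fin n → Fin n → ℝ) (σ π : Equiv.Perm (Fin n)) : ℝ :=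
  ∑ p ∈ Finset.univ.filter
      (fun p : Fin n × Fin n × Fin n => ({p.1, p.2.1, p.2.2} : Finset (Fin n)).card = 2),
    a p.1 (σ p.2.1) (π p.2.2)

/-- The ordered triples of pairwise distinct elements of `Fin n`. -/
def distinctTriples (n : ℕ) : Finset (Fin n × Fin n × Fin n) :=
  Finset.univ.filter (fun p => p.1 ≠ p.2.1 ∧ p.1 ≠ p.2.2 ∧ p.2.1 ≠ p.2.2)

theorem mem_distinctTriples {n : ℕ} {p : Fin n × Fin n × Fin n} :
    p ∈ distinctTriples n ↔ p.1 ≠ p.2.1 ∧ p.1 ≠ p.2.2 ∧ p.2.1 ≠ p.2.2 := by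
  simp [distinctTriples]

theorem sum_distinctTriples_rotate {n : ℕ} (F : Fin n → Fin n → Fin n → ℝ) :
    ∑ p ∈ distinctTriples n, F p.2.1 p.2.2 p.1 =
      ∑ p ∈ distinctTriples n, F p.1 p.2.1 p.2.2 := by
  refine Finset.sum_bij' (fun p _ => (p.2.1, p.2.2, p.1)) (fun p _ => (p.2.2, p.1, p.2.1))
    ?_ ?_ ?_ ?_ ?_ <;> simp only [mem_distinctTriples] <;> grind

theorem sum_distinctTriples_swap {n : ℕ} (F : Fin n → Fin n → Fin n → ℝ) :
    ∑ p ∈ distinctTriples n, F p.1 p.2.2 p.2.1 =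
      ∑ p ∈ distinctTriples n, F p.1 p.2.1 p.2.2 := by
  refine Finset.sum_bij' (fun p _ => (p.1, p.2.2, p.2.1)) (fun p _ => (p.1, p.2.2, p.2.1))
    ?_ ?_ ?_ ?_ ?_ <;> simp only [mem_distinctTriples] <;> grind

theorem sum_distinctTriples_fst {n : ℕ} (hn : 1 ≤ n) (g : Fin n → ℝ) :
    ∑ p ∈ distinctTriples n, g p.1 = ((n : ℝ) - 1) * (n - 2) * ∑ i, g i := by
  have hfiber (i : Fin n) : (Finset.univ.filter
      (fun q : Fin n × Fin n => i ≠ q.1 ∧ i ≠ q.2 ∧ q.1 ≠ q.2)) =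
      (Finset.univ.erase i).offDiag := by
    ext q
    simp only [Finset.mem_filter, Finset.mem_univ, true_and, Finset.mem_offDiag,
      Finset.mem_erase, and_true]
    grind
  have hcard (i : Fin n) : (((Finset.univ.erase i).offDiag.card : ℕ) : ℝ) =
      ((n : ℝ) - 1) * (n - 2) := by
    rw [Finset.offDiag_card, Finset.card_erase_of_mem (Finset.mem_univ i), Finset.card_univ,
      Fintype.card_fin, Nat.cast_sub (Nat.le_mul_self _)]
    push_cast [Nat.cast_sub hn]
    ring
  rw [distinctTriples, Finset.sum_filter, Fintype.sum_prod_type, Finset.mul_sum]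
  refine Finset.sum_congr rfl fun i _ => ?_
  dsimp only
  rw [← Finset.sum_filter, hfiber, Finset.sum_const, nsmul_eq_mul, hcard]

theorem sum_eq_distinct_add_two_add_diagonal {n : ℕ} (c : Fin n → Fin n → Fin n → ℝ) :
    ∑ i, ∑ j, ∑ k, c i j k =
      ∑ p ∈ distinctTriples n, c p.1 p.2.1 p.2.2 +
      ∑ p ∈ Finset.univ.filter
        (fun p : Fin n × Fin n × Fin n => ({p.1, p.2.1, p.2.2} : Finset (Fin n)).card = 2),
        c p.1 p.2.1 p.2.2 +
      ∑ i, c i i i := by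
  have hdiag : ∑ i, c i i i = ∑ p : Fin n × Fin n × Fin n,
      if p.1 = p.2.1 ∧ p.1 = p.2.2 then c p.1 p.2.1 p.2.2 else 0 := by
    simp [Fintype.sum_prod_type, ite_and]
  rw [hdiag, distinctTriples, Finset.sum_filter, Finset.sum_filter, ← Finset.sum_add_distrib,
    ← Finset.sum_add_distrib]
  simp only [Fintype.sum_prod_type]
  refine Finset.sum_congr rfl fun i _ => Finset.sum_congr rfl fun j _ =>
    Finset.sum_congr rfl fun k _ => ?_
  by_cases hij : i = j <;> by_cases hik : i = k <;> by_cases hjk : j = k <;>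
    simp_all [Finset.card_insert_of_notMem]

theorem sum_diagonal_sub_sum_perm {n : ℕ} (c : Fin n → Fin n → Fin n → ℝ)
    (u v : Equiv.Perm (Fin n)) {x y z : Fin n} (hxy : x ≠ y) (hxz : x ≠ z) (hyz : y ≠ z)
    (hu : ∀ i, i ≠ x → i ≠ y → i ≠ z → u i = i) (hv : ∀ i, i ≠ x → i ≠ y → i ≠ z → v i = i) :
    ∑ i, c i i i - ∑ i, c i (u i) (v i) =
      (c x x x - c x (u x) (v x)) + (c y y y - c y (u y) (v y)) +
        (c z z z - c z (u z) (v z)) := by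
  rw [← Finset.sum_sub_distrib, ← Finset.sum_subset (Finset.subset_univ {x, y, z})]
  · rw [Finset.sum_insert (by simp [hxy, hxz]), Finset.sum_pair hyz, add_assoc]
  · intro i _ hi
    simp only [Finset.mem_insert, Finset.mem_singleton, not_or] at hi
    rw [hu i hi.1 hi.2.1 hi.2.2, hv i hi.1 hi.2.1 hi.2.2, sub_self]

section ThreeCycle

variable {n : ℕ} {x y z : Fin n}

theorem tau1_apply_fst (hxy : x ≠ y) (hyz : y ≠ z) : tau1 x y z x = y := by
  simp [tau1, Equiv.swap_apply_of_ne_of_ne hxy.symm hyz]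

theorem tau1_apply_snd : tau1 x y z y = z := by
  simp [tau1]

theorem tau1_apply_trd (hxz : x ≠ z) (hyz : y ≠ z) : tau1 x y z z = x := by
  simp [tau1, Equiv.swap_apply_of_ne_of_ne hxz.symm hyz.symm]

theorem tau1_apply_of_ne {i : Fin n} (hx : i ≠ x) (hy : i ≠ y) (hz : i ≠ z) :
    tau1 x y z i = i := by
  simp [tau1, Equiv.swap_apply_of_ne_of_ne hx hy, Equiv.swap_apply_of_ne_of_ne hx hz]

theorem tau2_apply_fst (hxz : x ≠ z) (hyz : y ≠ z) : tau2 x y z x = z :=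
  Equiv.Perm.inv_eq_iff_eq.mpr (tau1_apply_trd hxz hyz).symm

theorem tau2_apply_snd (hxy : x ≠ y) (hyz : y ≠ z) : tau2 x y z y = x :=
  Equiv.Perm.inv_eq_iff_eq.mpr (tau1_apply_fst hxy hyz).symm

theorem tau2_apply_trd : tau2 x y z z = y :=
  Equiv.Perm.inv_eq_iff_eq.mpr tau1_apply_snd.symm

theorem tau2_apply_of_ne {i : Fin n} (hx : i ≠ x) (hy : i ≠ y) (hz : i ≠ z) :
    tau2 x y z i = i :=
  Equiv.Perm.inv_eq_iff_eq.mpr (tau1_apply_of_ne hx hy hz).symm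

end ThreeCycle

theorem sum_distinctTriples_half_sum_sub {n : ℕ} (hn : 1 ≤ n)
    (c : Fin n → Fin n → Fin n → ℝ) :
    ∑ p ∈ distinctTriples n,
      (((∑ i, c i i i) - ∑ i, c i (tau1 p.1 p.2.1 p.2.2 i) (tau2 p.1 p.2.1 p.2.2 i)) +
        ((∑ i, c i i i) - ∑ i, c i (tau2 p.1 p.2.1 p.2.2 i) (tau1 p.1 p.2.1 p.2.2 i))) / 2 =
      3 * (((n : ℝ) - 1) * (n - 2) * ∑ i, c i i i) -
        3 * ∑ p ∈ distinctTriples n, c p.1 p.2.1 p.2.2 := by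
  have hterm : ∀ p ∈ distinctTriples n,
      (((∑ i, c i i i) - ∑ i, c i (tau1 p.1 p.2.1 p.2.2 i) (tau2 p.1 p.2.1 p.2.2 i)) +
        ((∑ i, c i i i) - ∑ i, c i (tau2 p.1 p.2.1 p.2.2 i) (tau1 p.1 p.2.1 p.2.2 i))) / 2 =
      (c p.1 p.1 p.1 + c p.2.1 p.2.1 p.2.1 + c p.2.2 p.2.2 p.2.2) -
        ((c p.1 p.2.1 p.2.2 + c p.2.1 p.2.2 p.1 + c p.2.2 p.1 p.2.1) +
          (c p.1 p.2.2 p.2.1 + c p.2.1 p.1 p.2.2 + c p.2.2 p.2.1 p.1)) / 2 := by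
    rintro ⟨x, y, z⟩ hp
    obtain ⟨hxy, hxz, hyz⟩ := mem_distinctTriples.mp hp
    dsimp only at hxy hxz hyz ⊢
    rw [sum_diagonal_sub_sum_perm c _ _ hxy hxz hyz (fun _ => tau1_apply_of_ne)
        (fun _ => tau2_apply_of_ne),
      sum_diagonal_sub_sum_perm c _ _ hxy hxz hyz (fun _ => tau2_apply_of_ne)
        (fun _ => tau1_apply_of_ne),
      tau1_apply_fst hxy hyz, tau1_apply_snd, tau1_apply_trd hxz hyz,
      tau2_apply_fst hxz hyz, tau2_apply_snd hxy hyz, tau2_apply_trd]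
    ring
  rw [Finset.sum_congr rfl hterm]
  simp only [Finset.sum_sub_distrib, Finset.sum_add_distrib, ← Finset.sum_div]
  have hfst := sum_distinctTriples_fst hn fun i => c i i i
  have hsnd := sum_distinctTriples_rotate fun i _ _ => c i i i
  have htrd := sum_distinctTriples_rotate fun _ i _ => c i i i
  have hyzx := sum_distinctTriples_rotate c
  have hzxy := sum_distinctTriples_rotate fun i j k => c j k i
  have hxzy := sum_distinctTriples_swap c
  have hyxz := sum_distinctTriples_rotate fun i j k => c i k j
  have hzyx := sum_distinctTriples_rotate fun i j k => c j i k
  linarith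

/-- The average of `T₂ - T₂'` over the uniformly chosen pairwise distinct triple
`(i₁,i₂,i₃)` and the fair coin `b ∈ {1,2}` equals
`(3(n²-3n+3)/(n(n-1)(n-2)))·(T₂ - μ₂) - 9μ₂/(n(n-2)) + 3Y(σ,π)/(n(n-1)(n-2))`,
where `T₂ = ∑ i, a i (σ i) (π i)`, `μ₂ = (∑ i, ∑ j, ∑ k, a i j k)/n²`, and for `b = 1`
(resp. `b = 2`) `T₂' = ∑ i, a i (σ (τ₁ i)) (π (τ₂ i))` (resp. with `τ₁, τ₂` swapped). -/
theorem T2_conditional_expectation_identity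
    (n : ℕ) (hn : 3 ≤ n) (a : Fin n → Fin n → Fin n → ℝ)
    (ha : ∀ i j k, a i j k ∈ Set.Icc (0 : ℝ) 1) (σ π : Equiv.Perm (Fin n)) :
    (∑ p ∈ Finset.univ.filter
        (fun p : Fin n × Fin n × Fin n =>
          p.1 ≠ p.2.1 ∧ p.1 ≠ p.2.2 ∧ p.2.1 ≠ p.2.2),
      (((∑ i, a i (σ i) (π i)) -
          ∑ i, a i (σ (tau1 p.1 p.2.1 p.2.2 i)) (π (tau2 p.1 p.2.1 p.2.2 i))) +
        ((∑ i, a i (σ i) (π i)) -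
          ∑ i, a i (σ (tau2 p.1 p.2.1 p.2.2 i)) (π (tau1 p.1 p.2.1 p.2.2 i)))) / 2) /
      ((n : ℝ) * (n - 1) * (n - 2)) =
    (3 * ((n : ℝ) ^ 2 - 3 * n + 3) / ((n : ℝ) * (n - 1) * (n - 2))) *
        ((∑ i, a i (σ i) (π i)) - (∑ i, ∑ j, ∑ k, a i j k) / (n ^ 2 : ℝ)) -
      9 * ((∑ i, ∑ j, ∑ k, a i j k) / (n ^ 2 : ℝ)) / ((n : ℝ) * (n - 2)) +
      3 * Ystat a σ π / ((n : ℝ) * (n - 1) * (n - 2)) := by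
  have hn3 : (3 : ℝ) ≤ n := by exact_mod_cast hn
  have h0 : (n : ℝ) ≠ 0 := by linarith
  have h1 : (n : ℝ) - 1 ≠ 0 := by linarith
  have h2 : (n : ℝ) - 2 ≠ 0 := by linarith
  have htotal : ∑ i, ∑ j, ∑ k, a i (σ j) (π k) = ∑ i, ∑ j, ∑ k, a i j k := by
    refine Finset.sum_congr rfl fun i _ => ?_
    rw [← Equiv.sum_comp σ (fun j => ∑ k, a i j k)]
    exact Finset.sum_congr rfl fun j _ => Equiv.sum_comp π (a i (σ j))
  have hsplit := sum_eq_distinct_add_two_add_diagonal fun i j k => a i (σ j) (π k)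
  have hsum := sum_distinctTriples_half_sum_sub (by lia) fun i j k => a i (σ j) (π k)
  rw [htotal] at hsplit
  change _ = _ + Ystat a σ π + _ at hsplit
  rw [← distinctTriples, hsum, hsplit]
  field_simp
  ring
end
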